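/- arXiv:2310.18971 — 3 statements merged into one kernel-verified Lean document; each statement's English description precedes it below -/
import Mathlib

section
/- Let f : G → G be a graph map and let A = [x,y] be an arc in G. If (x,y) ∩ (V(G) ∪ P(f)) = ∅ and (x,y) ∩ R(f) ≠ ∅, then A ∩ EP(f) = ∅. -/
open Set Function Filter Topology Metric

noncomputable section

/-- An open arc: a subspace homeomorphic to the open interval `(0,1)`. -/
def IsOpenArc {G : Type*} [TopologicalSpace G] (A : Set G) : Prop :=
  Nonempty (A ≃ₜ Set.Ioo (0 : ℝ) 1)

/-- A circle: a subspace homeomorphic to the unit circle. -/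
def IsCircle {G : Type*} [TopologicalSpace G] (C : Set G) : Prop :=
  Nonempty (C ≃ₜ Metric.sphere (0 : ℂ) 1)

/-- A (topological) graph: a non-degenerate compact connected metric space with a finite
vertex set `V` such that every connected component of the complement of `V` is an open arc,
and every circle contains at least three vertices. -/
structure IsTopGraph {G : Type*} [MetricSpace G] (V : Set G) : Prop where
  nontrivial : Nontrivial G
  compact : CompactSpace G
  connected : ConnectedSpace G
  finite_vertexSet : V.Finite
  component_openArc : ∀ x ∈ Vᶜ, IsOpenArc (connectedComponentIn Vᶜ x)
  circle_vertices : ∀ C : Set G, IsCircle C → 3 ≤ (C ∩ V).ncard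

/-- The set of eventually periodic points: points with finite orbit. -/
def evPeriodicPts {G : Type*} (f : G → G) : Set G :=
  {x | (Set.range fun n : ℕ => f^[n] x).Finite}

/-- `EP_n(f)`: points whose orbit contains at most `n` points. -/
def evPeriodicPtsLe {G : Type*} (f : G → G) (n : ℕ) : Set G :=
  {x | (Set.range fun i : ℕ => f^[i] x).encard ≤ n}

/-- The ω-limit set of a point `x` under `f`. -/
def omegaSet {G : Type*} [TopologicalSpace G] (f : G → G) (x : G) : Set G :=
  ⋂ i : ℕ, closure (Set.range fun n : ℕ => f^[n + i] x)

/-- The ω-limit set of `f`. -/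
def omegaLimitSet {G : Type*} [TopologicalSpace G] (f : G → G) : Set G :=
  ⋃ x : G, omegaSet f x

/-- The set of recurrent points of `f`. -/
def recurrentPts {G : Type*} [TopologicalSpace G] (f : G → G) : Set G :=
  {x | x ∈ omegaSet f x}

/-- The set of non-wandering points of `f`. -/
def nonwanderingPts {G : Type*} [TopologicalSpace G] (f : G → G) : Set G :=
  {x | ∀ U : Set G, IsOpen U → x ∈ U → ∃ n : ℕ, 0 < n ∧ (f^[n] '' U ∩ U).Nonempty}

/-- The set of almost periodic points of `f`. -/
def almostPeriodicPts {G : Type*} [TopologicalSpace G] (f : G → G) : Set G :=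
  {x | ∀ U : Set G, IsOpen U → x ∈ U →
    ∃ m : ℕ, 0 < m ∧ ∀ n : ℕ, ∃ i : ℕ, 1 ≤ i ∧ i ≤ m ∧ f^[n + i] x ∈ U}

/-- The ω-limit set of `x` under the restriction `f|K` (closures taken in the subspace `K`). -/
def omegaSetIn {G : Type*} [TopologicalSpace G] (f : G → G) (K : Set G) (x : G) : Set G :=
  ⋂ i : ℕ, (closure (Set.range fun n : ℕ => f^[n + i] x) ∩ K)

/-- The ω-limit set `ω(f|K)` of the restriction of `f` to `K`. -/
def omegaLimitSetIn {G : Type*} [TopologicalSpace G] (f : G → G) (K : Set G) : Set G :=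
  ⋃ x ∈ K, omegaSetIn f K x

/-- The non-wandering set `Ω(f|K)` of the restriction of `f` to `K`. -/
def nonwanderingPtsIn {G : Type*} [TopologicalSpace G] (f : G → G) (K : Set G) : Set G :=
  {x | x ∈ K ∧ ∀ U : Set G, IsOpen U → x ∈ U →
    ∃ n : ℕ, 0 < n ∧ (f^[n] '' (U ∩ K) ∩ (U ∩ K)).Nonempty}

/-- The almost periodic set `AP(f|K)` of the restriction of `f` to `K`. -/
def almostPeriodicPtsIn {G : Type*} [TopologicalSpace G] (f : G → G) (K : Set G) : Set G :=
  {x | x ∈ K ∧ ∀ U : Set G, IsOpen U → x ∈ U →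
    ∃ m : ℕ, 0 < m ∧ ∀ n : ℕ, ∃ i : ℕ, 1 ≤ i ∧ i ≤ m ∧ f^[n + i] x ∈ U}

/-- The orbit `O(K,f)` of a set `K` under `f`. -/
def setOrbit {G : Type*} (f : G → G) (K : Set G) : Set G := ⋃ i : ℕ, f^[i] '' K

/-- The orbit segment `O_n(K,f)`. -/
def setOrbitSeg {G : Type*} (f : G → G) (K : Set G) (n : ℕ) : Set G :=
  ⋃ i ≤ n, f^[i] '' K

/-- The inverse orbit (absorbed set) `O₋(K,f)`. -/
def invOrbit {G : Type*} (f : G → G) (K : Set G) : Set G := ⋃ i : ℕ, f^[i] ⁻¹' K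

/-- The main absorbed set `Ab(K,f)`: the union of the connected components of `O₋(K,f)`
that meet `K`. -/
def mainAbsorbed {G : Type*} [TopologicalSpace G] (f : G → G) (K : Set G) : Set G :=
  ⋃ x ∈ K, connectedComponentIn (invOrbit f K) x

/-- A minimal set of `f`: nonempty, closed, invariant, with no proper such subset. -/
def IsMinimalSet {G : Type*} [TopologicalSpace G] (f : G → G) (M : Set G) : Prop :=
  M.Nonempty ∧ IsClosed M ∧ f '' M ⊆ M ∧
    ∀ N : Set G, N ⊆ M → N.Nonempty → IsClosed N → f '' N ⊆ N → N = M

open Classical in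
/-- The valence of a point `x` in a metric space: the limit, as `r → 0⁺`, of the number of
boundary points of the ball `B(x,r)` (defined as the eventual value, if it exists). -/
def valence {G : Type*} [MetricSpace G] (x : G) : ℕ :=
  if h : ∃ n : ℕ, ∀ᶠ r in nhdsWithin (0 : ℝ) (Set.Ioi 0),
      (frontier (Metric.ball x r)).ncard = n
  then h.choose else 0

/-- The set of branching points. -/
def branchPts (G : Type*) [MetricSpace G] : Set G := {x | 2 < valence x}

/-- The total branching number `ξ(U)` of a subset `U` of `G`. -/
def totalBranch {G : Type*} [MetricSpace G] (U : Set G) : ℕ :=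
  ∑ᶠ v ∈ U ∩ branchPts G, (valence v - 2)

/-- Cyclic successor on `Fin k`. -/
def finSucc {k : ℕ} (i : Fin k) : Fin k := ⟨(i.1 + 1) % k, Nat.mod_lt _ i.pos⟩

/-- `C : Fin k → Set G` enumerates the connected components of `X`, and `f` maps each
component into the (cyclically) next one. -/
def IsCyclicDecomp {G : Type*} [TopologicalSpace G] (f : G → G) (X : Set G)
    {k : ℕ} (C : Fin k → Set G) : Prop :=
  (⋃ i, C i) = X ∧ (∀ i, (C i).Nonempty) ∧
  (∀ i, ∀ x ∈ C i, connectedComponentIn X x = C i) ∧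
  Function.Injective C ∧ ∀ i, f '' C i ⊆ C (finSucc i)

/-- A component-cyclic `f`-invariant set. -/
def ComponentCyclic {G : Type*} [TopologicalSpace G] (f : G → G) (X : Set G) : Prop :=
  ∃ (k : ℕ) (C : Fin k → Set G), 0 < k ∧ IsCyclicDecomp f X C

/-- `A` is a connected component of `S`. -/
def IsCompOf {G : Type*} [TopologicalSpace G] (A S : Set G) : Prop :=
  ∃ x ∈ S, connectedComponentIn S x = A

/-- The distance between two sets. -/
def setDist {G : Type*} [MetricSpace G] (A B : Set G) : ℝ :=
  sInf {r : ℝ | ∃ a ∈ A, ∃ b ∈ B, dist a b = r}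

end


/-- A continuous curve in a compact Hausdorff space whose cluster points at the left end of its
parameter interval lie in a finite set converges there to a point of that set. -/
theorem exists_tendsto_of_finite_clusterPts {G : Type*} [TopologicalSpace G] [T2Space G]
    [CompactSpace G] {V : Set G} (hV : V.Finite) {c : ℝ → G} (hc : ContinuousOn c (Ioo 0 1))
    (h : ∀ x, MapClusterPt x (𝓝[>] (0 : ℝ)) c → x ∈ V) :
    ∃ v ∈ V, Tendsto c (𝓝[>] (0 : ℝ)) (𝓝 v) := by
  obtain ⟨U, hU, hUd⟩ := hV.t2_separation
  obtain ⟨v, hv⟩ : ∃ v, MapClusterPt v (𝓝[>] (0 : ℝ)) c :=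
    exists_clusterPt_of_compactSpace _
  have hvV := h v hv
  refine ⟨v, hvV, le_nhds_of_unique_clusterPt fun w hw => ?_⟩
  replace hw : MapClusterPt w (𝓝[>] (0 : ℝ)) c := hw
  by_contra hne
  have hwV := h w hw
  have hev : ∀ᶠ t in 𝓝[>] (0 : ℝ), c t ∈ ⋃ v ∈ V, U v := by
    by_contra hcon
    have hfr : ∃ᶠ t in 𝓝[>] (0 : ℝ), c t ∈ (⋃ v ∈ V, U v)ᶜ := not_eventually.1 hcon
    have hcl : IsClosed (⋃ v ∈ V, U v)ᶜ :=
      (isOpen_biUnion fun v _ => (hU v).2).isClosed_compl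
    obtain ⟨x, hx, hxc⟩ := hcl.isCompact.exists_mapClusterPt_of_frequently hfr
    exact hx (mem_biUnion (h x hxc) (hU x).1)
  obtain ⟨ε, hε, hεU⟩ := mem_nhdsGT_iff_exists_Ioo_subset.1
    (hev.and (Ioo_mem_nhdsGT (zero_lt_one' ℝ)))
  have hε' : Ioo 0 ε ∈ 𝓝[>] (0 : ℝ) := Ioo_mem_nhdsGT hε
  have hpre : IsPreconnected (c '' Ioo 0 ε) :=
    isPreconnected_Ioo.image _ (hc.mono fun t ht => (hεU ht).2)
  obtain ⟨t, htv, ht⟩ := ((hv.frequently ((hU v).2.mem_nhds (hU v).1)).and_eventually hε').exists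
  obtain ⟨s, hsw, hs⟩ := ((hw.frequently ((hU w).2.mem_nhds (hU w).1)).and_eventually hε').exists
  have hdis : Disjoint (U v) (⋃ u ∈ V \ {v}, U u) := by
    rw [disjoint_iUnion₂_right]
    intro u hu
    exact hUd hvV hu.1 fun he => hu.2 he.symm
  have hsub : c '' Ioo 0 ε ⊆ U v := by
    refine hpre.subset_left_of_subset_union (hU v).2
      (isOpen_biUnion fun u _ => (hU u).2) hdis ?_ ⟨c t, mem_image_of_mem _ ht, htv⟩
    rintro _ ⟨r, hr, rfl⟩
    obtain ⟨u, hu, hru⟩ := mem_iUnion₂.1 (hεU hr).1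
    by_cases huv : u = v
    · exact Or.inl (huv ▸ hru)
    · exact Or.inr (mem_biUnion ⟨hu, huv⟩ hru)
  exact (hUd hvV hwV (Ne.symm hne)).le_bot ⟨hsub (mem_image_of_mem _ hs), hsw⟩

/-- The image of a simple closed curve is a circle. -/
theorem isCircle_image_Ico {G : Type*} [TopologicalSpace G] [T2Space G] {T : ℝ} (hT : 0 < T)
    {l : ℝ → G} (hl : ContinuousOn l (Icc 0 T)) (h0 : l 0 = l T) (hi : InjOn l (Ico 0 T)) :
    IsCircle (l '' Ico 0 T) := by
  have : Fact (0 < T) := ⟨hT⟩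
  have hcont : Continuous (AddCircle.liftIco T 0 l) :=
    AddCircle.liftIco_continuous (by simpa using h0) (by simpa using hl)
  have hrep : ∀ x : AddCircle T, ∃ t ∈ Ico (0 : ℝ) T, (t : AddCircle T) = x := by
    intro x
    have := AddCircle.coe_image_Ico_eq T 0
    have hx : x ∈ ((↑) : ℝ → AddCircle T) '' Ico 0 (0 + T) := by rw [this]; trivial
    simpa using hx
  have hval : ∀ t ∈ Ico (0 : ℝ) T, AddCircle.liftIco T 0 l (t : AddCircle T) = l t :=
    fun t ht => AddCircle.liftIco_coe_apply (by simpa using ht)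
  have hinj : Injective (AddCircle.liftIco T 0 l) := by
    intro x y hxy
    obtain ⟨s, hs, rfl⟩ := hrep x
    obtain ⟨t, ht, rfl⟩ := hrep y
    rw [hval s hs, hval t ht] at hxy
    rw [hi hs ht hxy]
  have hrange : range (AddCircle.liftIco T 0 l) = l '' Ico 0 T := by
    ext y
    constructor
    · rintro ⟨x, rfl⟩
      obtain ⟨s, hs, rfl⟩ := hrep x
      exact ⟨s, hs, (hval s hs).symm⟩
    · rintro ⟨s, hs, rfl⟩
      exact ⟨s, hval s hs⟩
  rw [← hrange]
  exact ⟨(hcont.isClosedEmbedding hinj).isEmbedding.toHomeomorph.symm.trans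
    (AddCircle.homeomorphCircle hT.ne')⟩

/-- The left end of an edge, parametrized by the open unit interval, clusters only at vertices. -/
theorem cluster_end_mem {G : Type*} [TopologicalSpace G] {V : Set G} {x : G}
    (e : connectedComponentIn Vᶜ x ≃ₜ Ioo (0 : ℝ) 1) {c : ℝ → G}
    (hc : ∀ t : Ioo (0 : ℝ) 1, c t = e.symm t) {y : G}
    (hy : MapClusterPt y (𝓝[>] (0 : ℝ)) c) : y ∈ V := by
  by_contra hyV
  have hcm : ∀ t ∈ Ioo (0 : ℝ) 1, c t ∈ connectedComponentIn Vᶜ x := fun t ht => by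
    rw [hc ⟨t, ht⟩]; exact (e.symm _).2
  have hev : ∀ᶠ t in 𝓝[>] (0 : ℝ), t ∈ Ioo (0 : ℝ) 1 := Ioo_mem_nhdsGT one_pos
  have hycl : y ∈ closure (connectedComponentIn Vᶜ x) := by
    rw [mem_closure_iff_nhds]
    intro U hU
    obtain ⟨t, ht, ht'⟩ := ((hy.frequently hU).and_eventually hev).exists
    exact ⟨c t, ht, hcm t ht'⟩
  have hxV : x ∈ Vᶜ := by
    have := (e.symm ⟨1 / 2, by norm_num⟩).2
    exact connectedComponentIn_nonempty_iff.1 ⟨_, this⟩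
  have hymem : y ∈ connectedComponentIn Vᶜ x := by
    have hpre : IsPreconnected (insert y (connectedComponentIn Vᶜ x)) :=
      isPreconnected_connectedComponentIn.subset_closure (subset_insert _ _)
        (insert_subset hycl subset_closure)
    exact hpre.subset_connectedComponentIn (mem_insert_of_mem _ (mem_connectedComponentIn hxV))
      (insert_subset hyV (connectedComponentIn_subset _ _)) (mem_insert _ _)
  set s := e ⟨y, hymem⟩ with hs
  have hopen : IsOpen (e ⁻¹' {t | (s : ℝ) / 2 < t}) :=
    (isOpen_lt continuous_const continuous_subtype_val).preimage e.continuous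
  obtain ⟨U, hU, hUe⟩ := isOpen_induced_iff.1 hopen
  have hyU : y ∈ U := by
    have : (⟨y, hymem⟩ : connectedComponentIn Vᶜ x) ∈ Subtype.val ⁻¹' U := by
      rw [hUe]
      have := s.2.1
      simp only [mem_preimage, mem_ofPred_eq]
      rw [← hs]; linarith
    exact this
  have hev2 : ∀ᶠ t in 𝓝[>] (0 : ℝ), t ∈ Ioo (0 : ℝ) (s / 2) :=
    Ioo_mem_nhdsGT (by have := s.2.1; linarith)
  obtain ⟨t, htU, ht, ht2⟩ :=
    ((hy.frequently (hU.mem_nhds hyU)).and_eventually (hev.and hev2)).exists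
  have : e.symm ⟨t, ht⟩ ∈ Subtype.val ⁻¹' U := by
    rw [mem_preimage, ← hc ⟨t, ht⟩]; exact htU
  rw [hUe] at this
  simp only [mem_preimage, Homeomorph.apply_symm_apply, mem_ofPred_eq] at this
  exact absurd ht2.2 (not_lt.2 this.le)

/-- The reflection of the open unit interval about its midpoint. -/
def reflectIoo : Ioo (0 : ℝ) 1 ≃ₜ Ioo (0 : ℝ) 1 where
  toFun t := ⟨1 - t, by have := t.2.1; have := t.2.2; constructor <;> linarith⟩
  invFun t := ⟨1 - t, by have := t.2.1; have := t.2.2; constructor <;> linarith⟩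
  left_inv t := by ext; simp
  right_inv t := by ext; simp
  continuous_toFun := by fun_prop
  continuous_invFun := by fun_prop

/-- Every edge of a topological graph is the interior of an arc with both endpoints in the
vertex set. -/
theorem exists_edge_parametrization {G : Type*} [MetricSpace G] {V : Set G} (hG : IsTopGraph V)
    {x : G} (hx : x ∈ Vᶜ) :
    ∃ c : ℝ → G, ContinuousOn c (Icc 0 1) ∧ InjOn c (Icc 0 1) ∧
      c '' Ioo 0 1 = connectedComponentIn Vᶜ x ∧ c 0 ∈ V ∧ c 1 ∈ V := by
  have := hG.compact
  obtain ⟨e⟩ := hG.component_openArc x hx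
  set d : ℝ → G := fun t => if h : t ∈ Ioo (0 : ℝ) 1 then (e.symm ⟨t, h⟩ : G) else x with hd
  have hde : ∀ t : Ioo (0 : ℝ) 1, d t = e.symm t := fun t => by
    simp only [hd]; rw [dif_pos t.2]
  have hdc : ContinuousOn d (Ioo 0 1) := by
    rw [continuousOn_iff_continuous_domRestrict]
    exact (continuous_subtype_val.comp e.symm.continuous).congr fun t => (hde t).symm
  have hdi : InjOn d (Ioo 0 1) := by
    intro s hs t ht hst
    rw [hde ⟨s, hs⟩, hde ⟨t, ht⟩] at hst
    exact congrArg Subtype.val (e.symm.injective (Subtype.ext hst))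
  have hdr : d '' Ioo 0 1 = connectedComponentIn Vᶜ x := by
    ext y
    constructor
    · rintro ⟨t, ht, rfl⟩
      rw [hde ⟨t, ht⟩]; exact (e.symm _).2
    · intro hy
      exact ⟨e ⟨y, hy⟩, (e ⟨y, hy⟩).2, by rw [hde]; simp⟩
  have hrefl : MapsTo (fun t : ℝ => 1 - t) (Ioo 0 1) (Ioo 0 1) := fun t ht =>
    ⟨by linarith [ht.2], by linarith [ht.1]⟩
  obtain ⟨v, hvV, hv⟩ := exists_tendsto_of_finite_clusterPts hG.finite_vertexSet hdc
    fun y hy => cluster_end_mem e hde hy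
  obtain ⟨w, hwV, hw⟩ := exists_tendsto_of_finite_clusterPts (c := fun t => d (1 - t))
    hG.finite_vertexSet (hdc.comp (by fun_prop) hrefl)
    fun y hy => cluster_end_mem (e.trans reflectIoo) (fun t => hde (reflectIoo t)) hy
  have hw' : Tendsto d (𝓝[<] (1 : ℝ)) (𝓝 w) := by
    have h1 : Tendsto (fun t : ℝ => 1 - t) (𝓝[<] (1 : ℝ)) (𝓝[>] (0 : ℝ)) := by
      refine tendsto_nhdsWithin_iff.2 ⟨?_, ?_⟩
      · have : Tendsto (fun t : ℝ => 1 - t) (𝓝 1) (𝓝 (1 - 1)) :=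
          (continuous_const.sub continuous_id).tendsto 1
        rw [sub_self] at this
        exact this.mono_left nhdsWithin_le_nhds
      · filter_upwards [self_mem_nhdsWithin] with t ht
        exact sub_pos.2 (mem_Iio.1 ht)
    refine (hw.comp h1).congr fun t => ?_
    simp
  set c := extendFrom (Ioo (0 : ℝ) 1) d with hc
  have hcc : ContinuousOn c (Icc 0 1) := continuousOn_Icc_extendFrom_Ioo hdc hv hw'
  have hcd : ∀ t ∈ Ioo (0 : ℝ) 1, c t = d t := extendFrom_extends hdc
  have hc0 : c 0 = v := eq_lim_at_left_extendFrom_Ioo one_pos hv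
  have hc1 : c 1 = w := eq_lim_at_right_extendFrom_Ioo one_pos hw'
  have hcV : ∀ t ∈ Ioo (0 : ℝ) 1, c t ∉ V := fun t ht => by
    rw [hcd t ht]
    exact connectedComponentIn_subset Vᶜ x (hdr ▸ mem_image_of_mem d ht)
  have hci : InjOn c (Ioo 0 1) := hdi.congr fun t ht => (hcd t ht).symm
  have hico : InjOn c (Ico 0 1) := by
    intro s hs t ht hst
    rcases hs.1.eq_or_lt with rfl | hs0 <;> rcases ht.1.eq_or_lt with rfl | ht0
    · rfl
    · exact absurd (by rw [← hst, hc0]; exact hvV) (hcV t ⟨ht0, ht.2⟩)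
    · exact absurd (by rw [hst, hc0]; exact hvV) (hcV s ⟨hs0, hs.2⟩)
    · exact hci ⟨hs0, hs.2⟩ ⟨ht0, ht.2⟩ hst
  have hne : c 0 ≠ c 1 := by
    intro h01
    have hcirc := hG.circle_vertices _ (isCircle_image_Ico one_pos hcc h01 hico)
    have hsub : c '' Ico 0 1 ∩ V ⊆ {c 0} := by
      rintro _ ⟨⟨t, ht, rfl⟩, htV⟩
      rcases ht.1.eq_or_lt with rfl | ht0
      · rfl
      · exact absurd htV (hcV t ⟨ht0, ht.2⟩)
    have := ncard_le_ncard hsub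
    rw [ncard_singleton] at this
    omega
  refine ⟨c, hcc, ?_, ?_, hc0 ▸ hvV, hc1 ▸ hwV⟩
  · intro s hs t ht hst
    rcases hs.2.eq_or_lt with rfl | hs1 <;> rcases ht.2.eq_or_lt with rfl | ht1
    · rfl
    · rcases ht.1.eq_or_lt with rfl | ht0
      · exact absurd hst.symm hne
      · exact absurd (by rw [← hst, hc1]; exact hwV) (hcV t ⟨ht0, ht1⟩)
    · rcases hs.1.eq_or_lt with rfl | hs0
      · exact absurd hst hne
      · exact absurd (by rw [hst, hc1]; exact hwV) (hcV s ⟨hs0, hs1⟩)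
    · exact hico ⟨hs.1, hs1⟩ ⟨ht.1, ht1⟩ hst
  · rw [← hdr]
    exact image_congr hcd

/-- Two arcs with common endpoints, whose interiors contain no vertices, have intersecting
interiors: otherwise they would form a circle with only two vertices. -/
theorem exists_mem_interiors_of_same_ends {G : Type*} [MetricSpace G] {V : Set G}
    (hG : IsTopGraph V) {c d : ℝ → G} (hc : ContinuousOn c (Icc 0 1)) (hci : InjOn c (Icc 0 1))
    (hd : ContinuousOn d (Icc 0 1)) (hdi : InjOn d (Icc 0 1))
    (hcV : ∀ t ∈ Ioo (0 : ℝ) 1, c t ∉ V) (hdV : ∀ t ∈ Ioo (0 : ℝ) 1, d t ∉ V)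
    (hcv : c 0 ∈ V) (hcw : c 1 ∈ V) (h0 : c 0 = d 0) (h1 : c 1 = d 1) :
    (c '' Ioo 0 1 ∩ d '' Ioo 0 1).Nonempty := by
  by_contra hdis
  rw [not_nonempty_iff_eq_empty] at hdis
  have hcd : ∀ s ∈ Ioo (0 : ℝ) 1, ∀ t ∈ Ioo (0 : ℝ) 1, c s ≠ d t := fun s hs t ht he => by
    have : c s ∈ c '' Ioo 0 1 ∩ d '' Ioo 0 1 :=
      ⟨mem_image_of_mem _ hs, he ▸ mem_image_of_mem _ ht⟩
    rw [hdis] at this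
    exact this
  set l : ℝ → G := fun t => if t ≤ 1 then c t else d (2 - t) with hl
  have hlc : ∀ t, t ≤ 1 → l t = c t := fun t ht => if_pos ht
  have hld : ∀ t, 1 < t → l t = d (2 - t) := fun t ht => if_neg (not_le.2 ht)
  have hcont : ContinuousOn l (Icc 0 2) := by
    have hu : Icc (0 : ℝ) 2 = Icc 0 1 ∪ Icc 1 2 := by
      rw [Icc_union_Icc_eq_Icc] <;> norm_num
    rw [hu]
    refine ContinuousOn.union_of_isClosed ?_ ?_ isClosed_Icc isClosed_Icc
    · exact hc.congr fun t ht => hlc t ht.2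
    · have : ContinuousOn (fun t : ℝ => d (2 - t)) (Icc 1 2) :=
        hd.comp (by fun_prop) fun t ht => ⟨by linarith [ht.2], by linarith [ht.1]⟩
      refine this.congr fun t ht => ?_
      rcases ht.1.eq_or_lt with rfl | h
      · rw [hlc 1 le_rfl, h1]; norm_num
      · exact hld t h
  have hl02 : l 0 = l 2 := by
    rw [hlc 0 zero_le_one, hld 2 one_lt_two, h0]; norm_num
  have hmix : ∀ s t, 0 ≤ s → s ≤ 1 → 1 < t → t < 2 → l s ≠ l t := by
    intro s t hs0 hs1 ht1 ht2 he
    rw [hlc s hs1, hld t ht1] at he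
    have ht : 2 - t ∈ Ioo (0 : ℝ) 1 := ⟨by linarith, by linarith⟩
    rcases hs0.eq_or_lt with rfl | hs0
    · exact hdV _ ht (he ▸ hcv)
    rcases hs1.eq_or_lt with rfl | hs1
    · exact hdV _ ht (he ▸ hcw)
    exact hcd s ⟨hs0, hs1⟩ _ ht he
  have hinj : InjOn l (Ico 0 2) := by
    intro s hs t ht hst
    rcases le_or_gt s 1 with hs1 | hs1 <;> rcases le_or_gt t 1 with ht1 | ht1
    · rw [hlc s hs1, hlc t ht1] at hst
      exact hci ⟨hs.1, hs1⟩ ⟨ht.1, ht1⟩ hst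
    · exact absurd hst (hmix s t hs.1 hs1 ht1 ht.2)
    · exact absurd hst.symm (hmix t s ht.1 ht1 hs1 hs.2)
    · rw [hld s hs1, hld t ht1] at hst
      have := hdi ⟨by linarith [hs.2], by linarith⟩ ⟨by linarith [ht.2], by linarith⟩ hst
      linarith
  have hcirc := hG.circle_vertices _ (isCircle_image_Ico two_pos hcont hl02 hinj)
  have hsub : l '' Ico 0 2 ∩ V ⊆ {c 0, c 1} := by
    rintro _ ⟨⟨t, ht, rfl⟩, htV⟩
    rcases le_or_gt t 1 with ht1 | ht1
    · rw [hlc t ht1] at htV ⊢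
      rcases ht.1.eq_or_lt with rfl | ht0
      · simp
      rcases ht1.eq_or_lt with rfl | ht1
      · simp
      exact absurd htV (hcV t ⟨ht0, ht1⟩)
    · rw [hld t ht1] at htV
      exact absurd htV (hdV _ ⟨by linarith [ht.2], by linarith⟩)
  have h3 := ncard_le_ncard hsub
  have h4 := ncard_insert_le (c 0) {c 1}
  rw [ncard_singleton] at h4
  omega

/-- The edges of a topological graph are open. -/
theorem isOpen_edge {G : Type*} [MetricSpace G] {V : Set G} (hG : IsTopGraph V) (x : G) :
    IsOpen (connectedComponentIn Vᶜ x) := by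
  have : Nonempty G := ⟨x⟩
  choose! c hcc hci hcr hc0 hc1 using fun (y : G) (hy : y ∈ Vᶜ) =>
    exists_edge_parametrization hG hy
  have hcV : ∀ y ∈ Vᶜ, ∀ t ∈ Ioo (0 : ℝ) 1, c y t ∉ V := fun y hy t ht =>
    connectedComponentIn_subset Vᶜ y (hcr y hy ▸ mem_image_of_mem _ ht)
  set S : Set (Set G) := connectedComponentIn Vᶜ '' Vᶜ with hS
  have hfin : S.Finite := by
    choose! r hrV hr using fun (C : Set G) (hC : C ∈ S) => hC
    refine Finite.of_injOn (f := fun C => (c (r C) 0, c (r C) 1)) (t := V ×ˢ V) ?_ ?_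
      (hG.finite_vertexSet.prod hG.finite_vertexSet)
    · exact fun C hC => ⟨hc0 _ (hrV C hC), hc1 _ (hrV C hC)⟩
    · intro C hC D hD he
      obtain ⟨h0, h1⟩ := Prod.mk.inj he
      obtain ⟨y, hyC, hyD⟩ := exists_mem_interiors_of_same_ends hG
        (hcc _ (hrV C hC)) (hci _ (hrV C hC)) (hcc _ (hrV D hD)) (hci _ (hrV D hD))
        (hcV _ (hrV C hC)) (hcV _ (hrV D hD)) (hc0 _ (hrV C hC)) (hc1 _ (hrV C hC)) h0 h1
      rw [hcr _ (hrV C hC)] at hyC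
      rw [hcr _ (hrV D hD)] at hyD
      rw [← hr C hC, ← hr D hD, connectedComponentIn_eq hyC, connectedComponentIn_eq hyD]
  have hclosed : ∀ C ∈ S, IsClosed (C ∪ V) := by
    rintro _ ⟨y, hy, rfl⟩
    have h1 : IsClosed (c y '' Icc 0 1) := (isCompact_Icc.image_of_continuousOn (hcc y hy)).isClosed
    have h2 : connectedComponentIn Vᶜ y ∪ V = c y '' Icc 0 1 ∪ V := by
      ext z
      rw [← hcr y hy]
      constructor
      · rintro (⟨t, ht, rfl⟩ | h)
        · exact Or.inl ⟨t, Ioo_subset_Icc_self ht, rfl⟩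
        · exact Or.inr h
      · rintro (⟨t, ht, rfl⟩ | h)
        · rcases ht.1.eq_or_lt with rfl | ht0
          · exact Or.inr (hc0 y hy)
          rcases ht.2.eq_or_lt with rfl | ht1
          · exact Or.inr (hc1 y hy)
          exact Or.inl ⟨t, ⟨ht0, ht1⟩, rfl⟩
        · exact Or.inr h
    rw [h2]
    exact h1.union hG.finite_vertexSet.isClosed
  have hcompl : (connectedComponentIn Vᶜ x)ᶜ =
      V ∪ ⋃ C ∈ S \ {connectedComponentIn Vᶜ x}, (C ∪ V) := by
    ext y
    constructor
    · intro hy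
      by_cases hyV : y ∈ V
      · exact Or.inl hyV
      refine Or.inr (mem_biUnion ⟨⟨y, hyV, rfl⟩, fun he => hy ?_⟩
        (Or.inl (mem_connectedComponentIn hyV)))
      rw [mem_singleton_iff] at he
      rw [← he]
      exact mem_connectedComponentIn hyV
    · rintro (hyV | hy) hyx
      · exact connectedComponentIn_subset Vᶜ x hyx hyV
      · obtain ⟨C, ⟨⟨z, hz, rfl⟩, hCx⟩, hyC | hyV⟩ := mem_iUnion₂.1 hy
        · exact hCx ((connectedComponentIn_eq hyC).trans (connectedComponentIn_eq hyx).symm)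
        · exact connectedComponentIn_subset Vᶜ x hyx hyV
  rw [← isClosed_compl_iff, hcompl]
  exact hG.finite_vertexSet.isClosed.union
    ((hfin.subset sdiff_subset).isClosed_biUnion fun C hC => hclosed C hC.1)

/-- A subarc without endpoints of an open arc `C` that is open in the ambient space is open. -/
theorem isOpen_image_Ioo_of_subset_openArc {G : Type*} [TopologicalSpace G] {C : Set G}
    (hC : IsOpen C) (hCa : IsOpenArc C) {δ : ℝ → G} (hδ : ContinuousOn δ (Ioo 0 1))
    (hδi : InjOn δ (Ioo 0 1)) (hδC : MapsTo δ (Ioo 0 1) C) : IsOpen (δ '' Ioo 0 1) := by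
  classical
  obtain ⟨e⟩ := hCa
  set h : G → ℝ := fun x => if hx : x ∈ C then (e ⟨x, hx⟩ : ℝ) else 0 with hh
  have hhe : ∀ x : C, h x = e x := fun x => by simp only [hh]; rw [dif_pos x.2]
  have hhc : ContinuousOn h C := by
    rw [continuousOn_iff_continuous_domRestrict]
    exact (continuous_subtype_val.comp e.continuous).congr fun x => (hhe x).symm
  have hhi : InjOn h C := by
    intro x hx y hy hxy
    rw [hhe ⟨x, hx⟩, hhe ⟨y, hy⟩] at hxy
    exact congrArg Subtype.val (e.injective (Subtype.ext hxy))
  have hkc : ContinuousOn (h ∘ δ) (Ioo 0 1) := hhc.comp hδ hδC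
  have hki : InjOn (h ∘ δ) (Ioo 0 1) := hhi.comp hδi hδC
  rw [isOpen_iff_mem_nhds]
  rintro _ ⟨t, ht, rfl⟩
  obtain ⟨a, ha0, hat⟩ := exists_between ht.1
  obtain ⟨b, htb, hb1⟩ := exists_between ht.2
  have ha : a ∈ Ioo (0 : ℝ) 1 := ⟨ha0, hat.trans ht.2⟩
  have hb : b ∈ Ioo (0 : ℝ) 1 := ⟨ht.1.trans htb, hb1⟩
  have hsub : uIcc a b ⊆ Ioo 0 1 := by
    rw [uIcc_of_le (hat.trans htb).le]
    exact fun s hs => ⟨ha0.trans_le hs.1, hs.2.trans_lt hb1⟩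
  have hN : IsOpen (C ∩ h ⁻¹' Ioo (min (h (δ a)) (h (δ b))) (max (h (δ a)) (h (δ b)))) :=
    hhc.isOpen_inter_preimage hC isOpen_Ioo
  refine mem_of_superset (hN.mem_nhds ⟨hδC ht, ?_⟩) ?_
  · rcases hkc.strictMonoOn_of_injOn_Ioo one_pos hki with hm | hm
    · exact ⟨min_lt_of_left_lt (hm ha ht hat), lt_max_of_lt_right (hm ht hb htb)⟩
    · exact ⟨min_lt_of_right_lt (hm ht hb htb), lt_max_of_lt_left (hm ha ht hat)⟩
  · rintro x ⟨hxC, hx⟩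
    obtain ⟨s, hs, hsx⟩ := intermediate_value_uIcc (hkc.mono hsub)
      (Ioo_subset_Icc_self hx : h x ∈ uIcc ((h ∘ δ) a) ((h ∘ δ) b))
    exact ⟨s, hsub hs, hhi (hδC (hsub hs)) hxC hsx⟩

/-- The coordinate in `(0,1)` of a point on the open arc `δ '' (0,1)`, and `0` elsewhere. -/
noncomputable def arcCoord {G : Type*} (δ : ℝ → G) (x : G) : ℝ :=
  open Classical in if h : ∃ t ∈ Ioo (0 : ℝ) 1, δ t = x then h.choose else 0

/-- The representative in `(u, u + 1]` of the coordinate of `f^[k] (δ u)`, where the open arc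
`δ '' (0,1)` is viewed as the circle `ℝ / ℤ` with the complement of the arc collapsed to `0`. -/
noncomputable def liftCoord {G : Type*} (f : G → G) (δ : ℝ → G) (k : ℕ) (u : ℝ) : ℝ :=
  if u < arcCoord δ (f^[k] (δ u)) then arcCoord δ (f^[k] (δ u))
  else arcCoord δ (f^[k] (δ u)) + 1

/-- The open arc `δ '' (0,1)` is open, contains no periodic point and is avoided by the orbit of
the endpoint `δ 0`. -/
structure IsAperiodicArc {G : Type*} [TopologicalSpace G] (f : G → G) (δ : ℝ → G) : Prop where
  continuous : Continuous f
  continuousOn : ContinuousOn δ (Icc 0 1)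
  injOn : InjOn δ (Icc 0 1)
  isOpen : IsOpen (δ '' Ioo 0 1)
  notMem_periodicPts : ∀ t ∈ Ioo (0 : ℝ) 1, δ t ∉ periodicPts f
  iterate_notMem : ∀ k, f^[k] (δ 0) ∉ δ '' Ioo 0 1

namespace IsAperiodicArc

variable {G : Type*} [TopologicalSpace G] {f : G → G} {δ : ℝ → G}

theorem arcCoord_apply (h : IsAperiodicArc f δ) {t : ℝ} (ht : t ∈ Ioo (0 : ℝ) 1) :
    arcCoord δ (δ t) = t := by
  have hex : ∃ s ∈ Ioo (0 : ℝ) 1, δ s = δ t := ⟨t, ht, rfl⟩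
  rw [arcCoord, dif_pos hex]
  exact h.injOn (Ioo_subset_Icc_self hex.choose_spec.1) (Ioo_subset_Icc_self ht)
    hex.choose_spec.2

omit [TopologicalSpace G] in
theorem arcCoord_of_notMem {x : G} (hx : x ∉ δ '' Ioo 0 1) : arcCoord δ x = 0 :=
  dif_neg hx

theorem iterate_ne (h : IsAperiodicArc f δ) {k : ℕ} (hk : 0 < k) {t : ℝ}
    (ht : t ∈ Ioo (0 : ℝ) 1) : f^[k] (δ t) ≠ δ t :=
  fun he => h.notMem_periodicPts t ht ⟨k, hk, he⟩

omit [TopologicalSpace G] in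
theorem liftCoord_of_notMem {k : ℕ} {u : ℝ} (hu : 0 < u) (hx : f^[k] (δ u) ∉ δ '' Ioo 0 1) :
    liftCoord f δ k u = 1 := by
  rw [liftCoord, arcCoord_of_notMem hx, if_neg hu.not_gt, zero_add]

theorem liftCoord_of_lt (h : IsAperiodicArc f δ) {k : ℕ} {u s : ℝ} (hs : s ∈ Ioo (0 : ℝ) 1)
    (he : f^[k] (δ u) = δ s) (hus : u < s) : liftCoord f δ k u = s := by
  rw [liftCoord, he, h.arcCoord_apply hs, if_pos hus]

theorem liftCoord_of_gt (h : IsAperiodicArc f δ) {k : ℕ} {u s : ℝ} (hs : s ∈ Ioo (0 : ℝ) 1)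
    (he : f^[k] (δ u) = δ s) (hus : s < u) : liftCoord f δ k u = s + 1 := by
  rw [liftCoord, he, h.arcCoord_apply hs, if_neg hus.not_gt]

/-- The trichotomy for the position of an iterate of a point of the arc. -/
theorem liftCoord_cases (h : IsAperiodicArc f δ) {k : ℕ} (hk : 0 < k) {u : ℝ}
    (hu : u ∈ Ioo (0 : ℝ) 1) :
    (f^[k] (δ u) ∉ δ '' Ioo 0 1 ∧ liftCoord f δ k u = 1) ∨
    (∃ s ∈ Ioo (0 : ℝ) 1, f^[k] (δ u) = δ s ∧ u < s ∧ liftCoord f δ k u = s) ∨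
    (∃ s ∈ Ioo (0 : ℝ) 1, f^[k] (δ u) = δ s ∧ s < u ∧ liftCoord f δ k u = s + 1) := by
  by_cases hx : f^[k] (δ u) ∈ δ '' Ioo 0 1
  · obtain ⟨s, hs, he⟩ := hx
    rcases lt_trichotomy u s with hus | rfl | hus
    · exact Or.inr (Or.inl ⟨s, hs, he.symm, hus, h.liftCoord_of_lt hs he.symm hus⟩)
    · exact absurd he.symm (h.iterate_ne hk hu)
    · exact Or.inr (Or.inr ⟨s, hs, he.symm, hus, h.liftCoord_of_gt hs he.symm hus⟩)
  · exact Or.inl ⟨hx, liftCoord_of_notMem hu.1 hx⟩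

theorem lt_liftCoord (h : IsAperiodicArc f δ) {k : ℕ} (hk : 0 < k) {u : ℝ}
    (hu : u ∈ Ioo (0 : ℝ) 1) : u < liftCoord f δ k u := by
  rcases h.liftCoord_cases hk hu with ⟨-, he⟩ | ⟨s, hs, -, hus, he⟩ | ⟨s, hs, -, -, he⟩ <;> rw [he]
  · exact hu.2
  · exact hus
  · linarith [hs.1, hu.2]

theorem liftCoord_lt (h : IsAperiodicArc f δ) {k : ℕ} (hk : 0 < k) {u : ℝ}
    (hu : u ∈ Ioo (0 : ℝ) 1) : liftCoord f δ k u < u + 1 := by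
  rcases h.liftCoord_cases hk hu with ⟨-, he⟩ | ⟨s, hs, -, -, he⟩ | ⟨s, hs, -, hus, he⟩ <;> rw [he]
  · linarith [hu.1]
  · linarith [hu.1, hs.2]
  · linarith

theorem iterate_eq_of_lt_one (h : IsAperiodicArc f δ) {k : ℕ} (hk : 0 < k) {u : ℝ}
    (hu : u ∈ Ioo (0 : ℝ) 1) (h1 : liftCoord f δ k u < 1) :
    f^[k] (δ u) = δ (liftCoord f δ k u) := by
  rcases h.liftCoord_cases hk hu with ⟨-, he⟩ | ⟨s, hs, hes, -, he⟩ | ⟨s, hs, -, -, he⟩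
  · linarith
  · rw [he, hes]
  · linarith [hs.1]

theorem iterate_eq_of_one_lt (h : IsAperiodicArc f δ) {k : ℕ} (hk : 0 < k) {u : ℝ}
    (hu : u ∈ Ioo (0 : ℝ) 1) (h1 : 1 < liftCoord f δ k u) :
    f^[k] (δ u) = δ (liftCoord f δ k u - 1) := by
  rcases h.liftCoord_cases hk hu with ⟨-, he⟩ | ⟨s, hs, -, -, he⟩ | ⟨s, hs, hes, -, he⟩
  · linarith
  · linarith [hs.2]
  · rw [he, hes, add_sub_cancel_right]

/-- The arc is parametrized homeomorphically near each of its interior points. -/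
theorem eventually_near [T2Space G] (h : IsAperiodicArc f δ) {s a b : ℝ}
    (hs : s ∈ Ioo (0 : ℝ) 1) (ha : a < s) (hb : s < b) :
    ∀ᶠ y in 𝓝 (δ s), ∃ t ∈ Ioo (0 : ℝ) 1, a < t ∧ t < b ∧ y = δ t := by
  have hcl : IsClosed (δ '' (Icc 0 1 \ Ioo a b)) :=
    ((isCompact_Icc.diff isOpen_Ioo).image_of_continuousOn
      (h.continuousOn.mono sdiff_subset)).isClosed
  have hmem : δ s ∈ (δ '' (Icc 0 1 \ Ioo a b))ᶜ := by
    rintro ⟨t, ht, he⟩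
    have := h.injOn ht.1 (Ioo_subset_Icc_self hs) he
    exact ht.2 (this ▸ ⟨ha, hb⟩)
  filter_upwards [hcl.isOpen_compl.mem_nhds hmem, h.isOpen.mem_nhds (mem_image_of_mem _ hs)]
  rintro _ hy ⟨t, ht, rfl⟩
  have : t ∈ Ioo a b := by
    by_contra hcon
    exact hy ⟨t, ⟨Ioo_subset_Icc_self ht, hcon⟩, rfl⟩
  exact ⟨t, ht, this.1, this.2, rfl⟩

theorem continuousOn_iterate (h : IsAperiodicArc f δ) (k : ℕ) :
    ContinuousOn (fun t => f^[k] (δ t)) (Icc 0 1) :=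
  (h.continuous.iterate k).comp_continuousOn h.continuousOn

theorem continuousAt_iterate (h : IsAperiodicArc f δ) (k : ℕ) {u : ℝ} (hu : u ∈ Ioo (0 : ℝ) 1) :
    ContinuousAt (fun t => f^[k] (δ t)) u :=
  (h.continuousOn_iterate k).continuousAt (Icc_mem_nhds hu.1 hu.2)

theorem continuousAt_liftCoord [T2Space G] (h : IsAperiodicArc f δ) {k : ℕ} (hk : 0 < k) {u : ℝ}
    (hu : u ∈ Ioo (0 : ℝ) 1) : ContinuousAt (liftCoord f δ k) u := by
  have hIoo : ∀ᶠ t in 𝓝 u, t ∈ Ioo (0 : ℝ) 1 := isOpen_Ioo.mem_nhds hu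
  have hcont := h.continuousAt_iterate k hu
  rw [Metric.continuousAt_iff']
  intro ε hε
  rcases h.liftCoord_cases hk hu with ⟨hx, he⟩ | ⟨s, hs, hes, hus, he⟩ | ⟨s, hs, hes, hus, he⟩
  · obtain ⟨η, hη0, hη⟩ : ∃ η, 0 < η ∧ η < min ε (min (u / 2) ((1 - u) / 2)) :=
      exists_between (lt_min hε (lt_min (by linarith [hu.1]) (by linarith [hu.2])))
    have hηε := hη.trans_le (min_le_left _ _)
    have hηu := (hη.trans_le (min_le_right _ _)).trans_le (min_le_left _ _)
    have hηv := (hη.trans_le (min_le_right _ _)).trans_le (min_le_right _ _)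
    have hcl : IsClosed (δ '' Icc η (1 - η)) :=
      (isCompact_Icc.image_of_continuousOn
        (h.continuousOn.mono (Icc_subset_Icc hη0.le (by linarith)))).isClosed
    have hmem : f^[k] (δ u) ∈ (δ '' Icc η (1 - η))ᶜ := by
      rintro ⟨t, ht, he⟩
      exact hx ⟨t, ⟨hη0.trans_le ht.1, by linarith [ht.2]⟩, he⟩
    filter_upwards [hIoo, hcont.eventually (hcl.isOpen_compl.mem_nhds hmem),
      Ioo_mem_nhds (show u / 2 < u by linarith [hu.1])
        (show u < 1 - (1 - u) / 2 by linarith [hu.2])] with t ht hty htu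
    rw [he, Real.dist_eq, abs_lt]
    rcases h.liftCoord_cases hk ht with ⟨-, he'⟩ | ⟨r, hr, her, htr, he'⟩ | ⟨r, hr, her, htr, he'⟩
    · rw [he']; constructor <;> linarith
    · rw [he']
      have : 1 - η < r := by
        by_contra hcon
        exact hty ⟨r, ⟨by linarith [htu.1], not_lt.1 hcon⟩, her.symm⟩
      constructor <;> linarith [hr.2]
    · rw [he']
      have : r < η := by
        by_contra hcon
        exact hty ⟨r, ⟨not_lt.1 hcon, by linarith [htu.2]⟩, her.symm⟩
      constructor <;> linarith [hr.1]
  · obtain ⟨m, hum, hms⟩ := exists_between hus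
    have hmax : max m (s - ε) < s := max_lt hms (by linarith)
    have hev := h.eventually_near hs hmax (show s < s + ε by linarith)
    rw [← hes] at hev
    filter_upwards [hIoo, hcont.eventually hev, Iio_mem_nhds hum] with t ht htr htm
    obtain ⟨r, hr, hmr, hrs, her⟩ := htr
    rw [he, h.liftCoord_of_lt hr her ((mem_Iio.1 htm).trans ((le_max_left _ _).trans_lt hmr)),
      Real.dist_eq, abs_lt]
    have := (le_max_right m (s - ε)).trans_lt hmr
    constructor <;> linarith
  · obtain ⟨m, hsm, hmu⟩ := exists_between hus
    have hmin : s < min m (s + ε) := lt_min hsm (by linarith)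
    have hev := h.eventually_near hs (show s - ε < s by linarith) hmin
    rw [← hes] at hev
    filter_upwards [hIoo, hcont.eventually hev, Ioi_mem_nhds hmu] with t ht htr htm
    obtain ⟨r, hr, hmr, hrs, her⟩ := htr
    rw [he, h.liftCoord_of_gt hr her ((hrs.trans_le (min_le_left _ _)).trans (mem_Ioi.1 htm)),
      Real.dist_eq, abs_lt]
    have := hrs.trans_le (min_le_right m (s + ε))
    constructor <;> linarith

omit [TopologicalSpace G] in
/-- The lifted coordinates are compatible with composition modulo integers. -/
theorem exists_int_liftCoord_sub {n k : ℕ} {t u : ℝ} (he : f^[n] (δ t) = δ u) :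
    ∃ j : ℤ, liftCoord f δ (n + k) t - liftCoord f δ k u = j := by
  have : f^[n + k] (δ t) = f^[k] (δ u) := by rw [add_comm, iterate_add_apply, he]
  unfold liftCoord
  rw [this]
  split_ifs
  · exact ⟨0, by simp⟩
  · exact ⟨-1, by push_cast; ring⟩
  · exact ⟨1, by push_cast; ring⟩
  · exact ⟨0, by simp⟩

end IsAperiodicArc

/-- A continuous integer-valued real function on a preconnected set is constant. -/
theorem IsPreconnected.eq_of_int_valued {S : Set ℝ} (hS : IsPreconnected S) {g : ℝ → ℝ}
    (hg : ContinuousOn g S) (hi : ∀ t ∈ S, ∃ j : ℤ, g t = j) {s t : ℝ} (hs : s ∈ S)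
    (ht : t ∈ S) : g s = g t := by
  refine hS.constant_of_mapsTo (T := range ((↑) : ℤ → ℝ)) ?_ hg (fun t ht => ?_) hs ht
  · exact Int.isClosedEmbedding_coe_real.isEmbedding.isDiscrete_range
  · obtain ⟨j, hj⟩ := hi t ht
    exact ⟨j, hj.symm⟩

namespace IsAperiodicArc

variable {G : Type*} [TopologicalSpace G] [T2Space G] {f : G → G} {δ : ℝ → G}

theorem continuousOn_liftCoord (h : IsAperiodicArc f δ) {k : ℕ} (hk : 0 < k) :
    ContinuousOn (liftCoord f δ k) (Ioo 0 1) :=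
  fun _ ht => (h.continuousAt_liftCoord hk ht).continuousWithinAt

/-- If a recurrent point returns to its left under `f^[n]`, then some point on its left does
not. -/
theorem exists_liftCoord_le_one (h : IsAperiodicArc f δ) {n : ℕ} (hn : 0 < n) {z : ℝ}
    (hz : z ∈ Ioo (0 : ℝ) 1) (hrec : MapClusterPt (δ z) atTop fun l => f^[l] (δ z)) :
    ∃ t ∈ Ioc 0 z, liftCoord f δ n t ≤ 1 := by
  by_contra! hcon
  have hsub : ∀ t ∈ Ioc 0 z, t ∈ Ioo (0 : ℝ) 1 := fun t ht => ⟨ht.1, ht.2.trans_lt hz.2⟩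
  set B : ℝ → ℝ := fun t => liftCoord f δ n t - 1 with hB
  have hBlt : ∀ t ∈ Ioc 0 z, B t < t := fun t ht => by
    have := h.liftCoord_lt hn (hsub t ht)
    simp only [hB]; linarith
  have hBpos : ∀ t ∈ Ioc 0 z, 0 < B t := fun t ht => sub_pos.2 (hcon t ht)
  have hmem : ∀ k, B^[k] z ∈ Ioc 0 z := by
    intro k
    induction k with
    | zero => exact ⟨hz.1, le_rfl⟩
    | succ k ih =>
      rw [iterate_succ_apply']
      exact ⟨hBpos _ ih, (hBlt _ ih).le.trans ih.2⟩
  have hiter : ∀ k, f^[n * k] (δ z) = δ (B^[k] z) := by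
    intro k
    induction k with
    | zero => rfl
    | succ k ih =>
      rw [Nat.mul_succ, add_comm, iterate_add_apply, ih, iterate_succ_apply',
        h.iterate_eq_of_one_lt hn (hsub _ (hmem k)) (hcon _ (hmem k))]
  have hanti : Antitone fun k => B^[k] z := antitone_nat_of_succ_le fun k => by
    simp only [iterate_succ_apply']
    exact (hBlt _ (hmem k)).le
  have hbdd : BddBelow (range fun k => B^[k] z) := ⟨0, by
    rintro _ ⟨k, rfl⟩
    exact (hmem k).1.le⟩
  have hlim := tendsto_atTop_ciInf hanti hbdd
  set b := ⨅ k, B^[k] z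
  have hb0 : 0 ≤ b := ge_of_tendsto' hlim fun k => (hmem k).1.le
  have hbz : b ≤ z := le_of_tendsto' hlim fun k => (hmem k).2
  rcases hb0.eq_or_lt with hb | hb
  · have hδ : Tendsto (fun k => δ (B^[k] z)) atTop (𝓝 (δ 0)) := by
      have h0 : ContinuousWithinAt δ (Icc 0 1) 0 := h.continuousOn 0 ⟨le_rfl, zero_le_one⟩
      refine h0.tendsto.comp (tendsto_nhdsWithin_iff.2 ⟨hb ▸ hlim, Eventually.of_forall fun k => ?_⟩)
      exact Ioo_subset_Icc_self (hsub _ (hmem k))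
    have hfar : ∀ r, ∃ U ∈ 𝓝 (δ z), ∀ᶠ k in atTop, f^[r] (δ (B^[k] z)) ∉ U := by
      intro r
      have hne : δ z ≠ f^[r] (δ 0) := fun he =>
        h.iterate_notMem r (he ▸ mem_image_of_mem δ hz)
      obtain ⟨U, W, hU, hW, hzU, hW0, hd⟩ := t2_separation hne
      refine ⟨U, hU.mem_nhds hzU, ?_⟩
      have := ((h.continuous.iterate r).tendsto (δ 0)).comp hδ
      filter_upwards [this.eventually (hW.mem_nhds hW0)] with k hk hkU
      exact hd.le_bot ⟨hkU, hk⟩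
    choose U hU hUev using hfar
    have hW : (⋂ r ∈ Finset.range n, U r) ∈ 𝓝 (δ z) :=
      (Filter.biInter_finset_mem _).2 fun r _ => hU r
    have hev : ∀ᶠ k in atTop, ∀ r ∈ Finset.range n, f^[r] (δ (B^[k] z)) ∉ U r :=
      (Filter.eventually_all_finset _).2 fun r _ => hUev r
    obtain ⟨K, hK⟩ := eventually_atTop.1 hev
    obtain ⟨l, hl, hlK⟩ :=
      ((hrec.frequently hW).and_eventually (eventually_ge_atTop (n * K))).exists
    have hr : l % n ∈ Finset.range n := Finset.mem_range.2 (Nat.mod_lt _ hn)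
    refine hK (l / n) ((Nat.le_div_iff_mul_le hn).2 (by rwa [mul_comm])) _ hr ?_
    rw [← hiter, ← iterate_add_apply, Nat.mod_add_div]
    exact mem_iInter₂.1 hl _ hr
  · have hbmem : b ∈ Ioc 0 z := ⟨hb, hbz⟩
    have hBc : ContinuousAt B b := (h.continuousAt_liftCoord hn (hsub b hbmem)).sub_const 1
    have h1 : Tendsto (fun k => B^[k + 1] z) atTop (𝓝 (B b)) := by
      simp only [iterate_succ_apply']
      exact hBc.tendsto.comp hlim
    have h2 := tendsto_nhds_unique h1 ((tendsto_add_atTop_iff_nat 1).2 hlim)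
    exact absurd h2 (hBlt b hbmem).ne

/-- The last point before `z` that is not sent to its left is sent to the endpoint `δ 0`. -/
theorem exists_last_preimage (h : IsAperiodicArc f δ) {n : ℕ} (hn : 0 < n) {t₀ z : ℝ}
    (hz : z < 1) (ht₀ : t₀ ∈ Ioc 0 z) (ht₀n : liftCoord f δ n t₀ ≤ 1)
    (hzn : 1 < liftCoord f δ n z) :
    ∃ c ∈ Ioo 0 z, liftCoord f δ n c = 1 ∧ (∀ t ∈ Ioc c z, 1 < liftCoord f δ n t) ∧
      f^[n] (δ c) = δ 0 := by
  have hsub : Icc t₀ z ⊆ Ioo 0 1 := fun t ht => ⟨ht₀.1.trans_le ht.1, ht.2.trans_lt hz⟩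
  have hFc : ContinuousOn (liftCoord f δ n) (Icc t₀ z) := (h.continuousOn_liftCoord hn).mono hsub
  have hT : IsCompact (Icc t₀ z ∩ liftCoord f δ n ⁻¹' Iic 1) :=
    isCompact_Icc.of_isClosed_subset
      (hFc.preimage_isClosed_of_isClosed isClosed_Icc isClosed_Iic) inter_subset_left
  obtain ⟨c, ⟨hc, hc1⟩, hmax⟩ := hT.exists_isGreatest ⟨t₀, ⟨le_rfl, ht₀.2⟩, ht₀n⟩
  have hcz : c < z := hc.2.lt_of_ne fun he => by
    rw [he] at hc1
    exact absurd hzn (not_lt.2 hc1)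
  have hc01 := hsub hc
  have hgt : ∀ t ∈ Ioc c z, 1 < liftCoord f δ n t := fun t ht => by
    by_contra hcon
    exact absurd (hmax ⟨⟨hc.1.trans ht.1.le, ht.2⟩, not_lt.1 hcon⟩) (not_le.2 ht.1)
  have hev : ∀ᶠ t in 𝓝[>] c, t ∈ Ioc c z := Ioc_mem_nhdsGT hcz
  have hFt : Tendsto (liftCoord f δ n) (𝓝[>] c) (𝓝 (liftCoord f δ n c)) :=
    (h.continuousAt_liftCoord hn hc01).tendsto.mono_left nhdsWithin_le_nhds
  have hc1' : liftCoord f δ n c = 1 :=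
    le_antisymm hc1 (ge_of_tendsto hFt (hev.mono fun t ht => (hgt t ht).le))
  refine ⟨c, ⟨hc01.1, hcz⟩, hc1', hgt, ?_⟩
  have h1 : Tendsto (fun t => f^[n] (δ t)) (𝓝[>] c) (𝓝 (f^[n] (δ c))) :=
    (h.continuousAt_iterate n hc01).tendsto.mono_left nhdsWithin_le_nhds
  have h2 : Tendsto (fun t => δ (liftCoord f δ n t - 1)) (𝓝[>] c) (𝓝 (δ 0)) := by
    have h0 : ContinuousWithinAt δ (Icc 0 1) 0 := h.continuousOn 0 ⟨le_rfl, zero_le_one⟩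
    refine h0.tendsto.comp (tendsto_nhdsWithin_iff.2 ⟨?_, ?_⟩)
    · have := hFt.sub_const 1
      rwa [hc1', sub_self] at this
    · filter_upwards [hev] with t ht
      have h3 := hgt t ht
      have h4 := h.liftCoord_lt hn (hsub ⟨hc.1.trans ht.1.le, ht.2⟩)
      exact ⟨by linarith, by linarith [ht.2]⟩
  refine tendsto_nhds_unique h1 (h2.congr' ?_)
  filter_upwards [hev] with t ht
  exact (h.iterate_eq_of_one_lt hn (hsub ⟨hc.1.trans ht.1.le, ht.2⟩) (hgt t ht)).symm

/-- A recurrent point of an aperiodic arc cannot return to its left, and afterwards return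
again strictly between the two positions. -/
theorem false_of_returns (h : IsAperiodicArc f δ) {n p : ℕ} (hn : 0 < n) (hp : 0 < p)
    {z z₁ z₂ : ℝ} (h0 : 0 < z₁) (h12 : z₁ < z₂) (h2z : z₂ < z) (hz1 : z < 1)
    (hzn : f^[n] (δ z) = δ z₁) (hzp : f^[p] (δ z₁) = δ z₂)
    (hrec : MapClusterPt (δ z) atTop fun l => f^[l] (δ z)) : False := by
  have hz : z ∈ Ioo (0 : ℝ) 1 := ⟨by linarith, hz1⟩
  have hz₁ : z₁ ∈ Ioo (0 : ℝ) 1 := ⟨h0, by linarith⟩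
  have hz₂ : z₂ ∈ Ioo (0 : ℝ) 1 := ⟨by linarith, by linarith⟩
  have hFz : liftCoord f δ n z = z₁ + 1 := h.liftCoord_of_gt hz₁ hzn (by linarith)
  obtain ⟨t₀, ht₀, ht₀n⟩ := h.exists_liftCoord_le_one hn hz hrec
  obtain ⟨c, hc, hc1, hgt, hc0⟩ :=
    h.exists_last_preimage hn hz1 ht₀ ht₀n (by rw [hFz]; linarith)
  have hc01 : c ∈ Ioo (0 : ℝ) 1 := ⟨hc.1, hc.2.trans hz1⟩
  have hsub : ∀ t ∈ Ioc c z, t ∈ Ioo (0 : ℝ) 1 := fun t ht => ⟨hc.1.trans ht.1, ht.2.trans_lt hz1⟩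
  set B : ℝ → ℝ := fun t => liftCoord f δ n t - 1 with hB
  have hBmem : ∀ t ∈ Ioc c z, B t ∈ Ioo (0 : ℝ) 1 := fun t ht => by
    have h3 := hgt t ht
    have h4 := h.liftCoord_lt hn (hsub t ht)
    exact ⟨sub_pos.2 h3, by simp only [hB]; linarith [ht.2]⟩
  have hBc : ContinuousOn B (Icc c z) :=
    ((h.continuousOn_liftCoord hn).mono fun t ht =>
      ⟨hc.1.trans_le ht.1, ht.2.trans_lt hz1⟩).sub continuousOn_const
  have hBc0 : B c = 0 := by simp only [hB, hc1, sub_self]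
  have hBz : B z = z₁ := by simp only [hB, hFz, add_sub_cancel_right]
  have hevc : ∀ᶠ t in 𝓝[>] c, t ∈ Ioc c z := Ioc_mem_nhdsGT hc.2
  have hBlim : Tendsto B (𝓝[>] c) (𝓝[>] 0) := by
    refine tendsto_nhdsWithin_iff.2 ⟨?_, hevc.mono fun t ht => (hBmem t ht).1⟩
    rw [← hBc0]
    exact Tendsto.mono_left ((h.continuousAt_liftCoord hn hc01).sub_const 1) nhdsWithin_le_nhds
  -- points of `(0, B t]` are of the form `B t'` with `t'` in `(c, t]`
  have hsurj : ∀ t ∈ Ioc c z, ∀ s ∈ Ioc 0 (B t), ∃ t' ∈ Ioc c t, B t' = s := by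
    intro t ht s hs
    obtain ⟨t', ht', he⟩ := intermediate_value_Icc ht.1.le
      (hBc.mono (Icc_subset_Icc_right ht.2)) (by rw [hBc0]; exact ⟨hs.1.le, hs.2⟩)
    refine ⟨t', ⟨ht'.1.lt_of_ne ?_, ht'.2⟩, he⟩
    rintro rfl
    rw [hBc0] at he
    exact hs.1.ne he
  have hconst : ∀ q, 0 < q → ∀ s ∈ Ioc c z, ∀ t ∈ Ioc c z,
      liftCoord f δ (n + q) s - liftCoord f δ q (B s) =
        liftCoord f δ (n + q) t - liftCoord f δ q (B t) := by
    intro q hq s hs t ht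
    refine isPreconnected_Ioc.eq_of_int_valued
      (g := fun t => liftCoord f δ (n + q) t - liftCoord f δ q (B t)) ?_ ?_ hs ht
    · refine ((h.continuousOn_liftCoord (by omega)).mono hsub).sub ?_
      exact (h.continuousOn_liftCoord hq).comp (hBc.mono Ioc_subset_Icc_self) hBmem
    · intro t ht
      exact exists_int_liftCoord_sub (h.iterate_eq_of_one_lt hn (hsub t ht) (hgt t ht))
  have hlim1 : ∀ q, Tendsto (liftCoord f δ (n + q)) (𝓝[>] c) (𝓝 1) := by
    intro q
    have hval : liftCoord f δ (n + q) c = 1 := by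
      refine liftCoord_of_notMem hc01.1 ?_
      rw [add_comm, iterate_add_apply, hc0]
      exact h.iterate_notMem q
    rw [← hval]
    exact (h.continuousAt_liftCoord (by omega) hc01).tendsto.mono_left nhdsWithin_le_nhds
  -- if `f^[q]` lifts continuously by `0 ↦ 0`, it moves `(0, z₁]` to the right, but not beyond `z`
  have hstay : ∀ q, 0 < q → Tendsto (liftCoord f δ q) (𝓝[>] 0) (𝓝 0) →
      ∀ s ∈ Ioc 0 z₁, liftCoord f δ q s < z := by
    intro q hq hq0 s hs
    have hone : ∀ t ∈ Ioc c z, liftCoord f δ (n + q) t - liftCoord f δ q (B t) = 1 := by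
      intro t ht
      have h1 : Tendsto (fun t => liftCoord f δ (n + q) t - liftCoord f δ q (B t)) (𝓝[>] c)
          (𝓝 (1 - 0)) := (hlim1 q).sub (hq0.comp hBlim)
      rw [sub_zero] at h1
      refine tendsto_nhds_unique (tendsto_const_nhds.congr' ?_) h1
      filter_upwards [hevc] with r hr using hconst q hq t ht r hr
    obtain ⟨t, ht, rfl⟩ := hsurj z ⟨hc.2, le_rfl⟩ s (by rwa [hBz])
    have h1 := hone t ht
    have h2 := h.liftCoord_lt (show 0 < n + q by omega) (hsub t ht)
    linarith [ht.2]
  have hbase : Tendsto (liftCoord f δ p) (𝓝[>] 0) (𝓝 0) := by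
    have hone : ∀ t ∈ Ioc c z, liftCoord f δ (n + p) t - liftCoord f δ p (B t) = 1 := by
      intro t ht
      rw [hconst p hp t ht z ⟨hc.2, le_rfl⟩, hBz, h.liftCoord_of_lt hz₂ hzp h12,
        h.liftCoord_of_gt hz₂ (by rw [add_comm, iterate_add_apply, hzn, hzp]) h2z]
      ring
    rw [Metric.tendsto_nhds]
    intro ε hε
    obtain ⟨t₁, ht₁, hsub₁⟩ := mem_nhdsGT_iff_exists_Ioc_subset.1
      (((Metric.tendsto_nhds.1 (hlim1 p)) ε hε).and hevc)
    have ht₁z : t₁ ∈ Ioc c z := (hsub₁ ⟨ht₁, le_rfl⟩).2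
    filter_upwards [Ioc_mem_nhdsGT (hBmem t₁ ht₁z).1] with s hs
    obtain ⟨t, ht, rfl⟩ := hsurj t₁ ht₁z s hs
    have h1 := (hsub₁ ht).1
    have h2 := hone t (hsub₁ ht).2
    rw [Real.dist_eq] at h1 ⊢
    rwa [show liftCoord f δ p (B t) - 0 = liftCoord f δ (n + p) t - 1 by linarith]
  have hsub₁ : ∀ s ∈ Ioc 0 z₁, s ∈ Ioo (0 : ℝ) 1 := fun s hs => ⟨hs.1, hs.2.trans_lt hz₁.2⟩
  have hev0 : ∀ᶠ s in 𝓝[>] (0 : ℝ), s ∈ Ioc 0 z₁ := Ioc_mem_nhdsGT h0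
  have hstep : ∀ q, 0 < q → Tendsto (liftCoord f δ q) (𝓝[>] 0) (𝓝 0) →
      ∀ s ∈ Ioc 0 z₁, liftCoord f δ (q + p) s = liftCoord f δ p (liftCoord f δ q s) := by
    intro q hq hq0 s hs
    have hmem : ∀ s ∈ Ioc 0 z₁, liftCoord f δ q s ∈ Ioo (0 : ℝ) 1 := fun s hs =>
      ⟨hs.1.trans (h.lt_liftCoord hq (hsub₁ s hs)), (hstay q hq hq0 s hs).trans hz1⟩
    have hint : ∀ s ∈ Ioc 0 z₁, ∃ j : ℤ,
        liftCoord f δ (q + p) s - liftCoord f δ p (liftCoord f δ q s) = j := fun s hs =>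
      exists_int_liftCoord_sub (h.iterate_eq_of_lt_one hq (hsub₁ s hs) (hmem s hs).2)
    have hcomp : Tendsto (fun s => liftCoord f δ p (liftCoord f δ q s)) (𝓝[>] 0) (𝓝 0) :=
      hbase.comp (tendsto_nhdsWithin_iff.2 ⟨hq0, hev0.mono fun s hs => (hmem s hs).1⟩)
    obtain ⟨r, hr1, hr⟩ := ((hcomp.eventually (Iio_mem_nhds one_pos)).and hev0).exists
    have heq : liftCoord f δ (q + p) s - liftCoord f δ p (liftCoord f δ q s) =
        liftCoord f δ (q + p) r - liftCoord f δ p (liftCoord f δ q r) := by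
      refine isPreconnected_Ioc.eq_of_int_valued
        (g := fun s => liftCoord f δ (q + p) s - liftCoord f δ p (liftCoord f δ q s))
        ?_ hint hs hr
      refine ((h.continuousOn_liftCoord (by omega)).mono hsub₁).sub ?_
      exact (h.continuousOn_liftCoord hp).comp ((h.continuousOn_liftCoord hq).mono hsub₁) hmem
    obtain ⟨j, hj⟩ := hint r hr
    have b1 := h.lt_liftCoord (show 0 < q + p by omega) (hsub₁ r hr)
    have b2 := h.liftCoord_lt (show 0 < q + p by omega) (hsub₁ r hr)
    have b3 := h.lt_liftCoord hp (hmem r hr)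
    have b4 := h.lt_liftCoord hq (hsub₁ r hr)
    have hr1' : liftCoord f δ p (liftCoord f δ q r) < 1 := hr1
    have hj1 : (j : ℝ) < 1 := by linarith
    have hj2 : (-1 : ℝ) < j := by linarith [hr.1]
    have hj0 : j = 0 := by
      have : j < 1 := by exact_mod_cast hj1
      have : -1 < j := by exact_mod_cast hj2
      omega
    rw [hj, hj0, Int.cast_zero] at heq
    linarith
  have hall : ∀ k : ℕ, Tendsto (liftCoord f δ ((k + 1) * p)) (𝓝[>] 0) (𝓝 0) := by
    intro k
    induction k with
    | zero => simpa using hbase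
    | succ k ih =>
      have hpos : 0 < (k + 1) * p := by positivity
      rw [show (k + 1 + 1) * p = (k + 1) * p + p by ring]
      have hcomp : Tendsto (fun s => liftCoord f δ p (liftCoord f δ ((k + 1) * p) s))
          (𝓝[>] 0) (𝓝 0) := by
        refine hbase.comp (tendsto_nhdsWithin_iff.2 ⟨ih, hev0.mono fun s hs => ?_⟩)
        exact hs.1.trans (h.lt_liftCoord hpos (hsub₁ s hs))
      refine hcomp.congr' ?_
      filter_upwards [hev0] with s hs using (hstep _ hpos ih s hs).symm
  set a : ℕ → ℝ := fun k => liftCoord f δ ((k + 1) * p) z₁ with ha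
  have hz₁mem : z₁ ∈ Ioc 0 z₁ := ⟨h0, le_rfl⟩
  have hpos : ∀ k, 0 < (k + 1) * p := fun k => by positivity
  have haz : ∀ k, a k < z := fun k => hstay _ (hpos k) (hall k) z₁ hz₁mem
  have ha0 : ∀ k, z₁ < a k := fun k => h.lt_liftCoord (hpos k) hz₁
  have hasucc : ∀ k, a (k + 1) = liftCoord f δ p (a k) := fun k => by
    simp only [ha]
    rw [show (k + 1 + 1) * p = (k + 1) * p + p by ring]
    exact hstep _ (hpos k) (hall k) z₁ hz₁mem
  have hmono : Monotone a := monotone_nat_of_le_succ fun k => by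
    rw [hasucc]
    exact (h.lt_liftCoord hp ⟨h0.trans (ha0 k), (haz k).trans hz1⟩).le
  have hlim := tendsto_atTop_ciSup hmono ⟨z, by rintro _ ⟨k, rfl⟩; exact (haz k).le⟩
  set A := ⨆ k, a k
  have hA : A ∈ Ioo (0 : ℝ) 1 :=
    ⟨h0.trans_le (ge_of_tendsto' hlim fun k => (ha0 k).le),
      (le_of_tendsto' hlim fun k => (haz k).le).trans_lt hz1⟩
  have h1 : Tendsto (fun k => a (k + 1)) atTop (𝓝 (liftCoord f δ p A)) := by
    simp only [hasucc]
    exact (h.continuousAt_liftCoord hp hA).tendsto.comp hlim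
  have h2 := tendsto_nhds_unique h1 ((tendsto_add_atTop_iff_nat 1).2 hlim)
  exact absurd h2 (h.lt_liftCoord hp hA).ne'

/-- A recurrent point of an aperiodic arc comes back arbitrarily close to itself. -/
theorem exists_return (h : IsAperiodicArc f δ) {u a b : ℝ} (hu : u ∈ Ioo (0 : ℝ) 1)
    (hau : a < u) (hub : u < b) (hrec : MapClusterPt (δ u) atTop fun l => f^[l] (δ u)) (N : ℕ) :
    ∃ l > N, ∃ s ∈ Ioo (0 : ℝ) 1, a < s ∧ s < b ∧ s ≠ u ∧ f^[l] (δ u) = δ s := by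
  obtain ⟨l, ⟨s, hs, has, hsb, he⟩, hl⟩ := ((hrec.frequently
    (h.eventually_near hu hau hub)).and_eventually (eventually_gt_atTop N)).exists
  refine ⟨l, hl, s, hs, has, hsb, ?_, he⟩
  rintro rfl
  exact h.iterate_ne (by omega) hs he

/-- An aperiodic arc contains no recurrent point. -/
theorem not_recurrent (h : IsAperiodicArc f δ) {z : ℝ} (hz : z ∈ Ioo (0 : ℝ) 1)
    (hrec : MapClusterPt (δ z) atTop fun l => f^[l] (δ z)) : False := by
  have hiter : ∀ {l s t}, MapClusterPt (δ s) atTop (fun l => f^[l] (δ s)) →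
      f^[l] (δ s) = δ t → MapClusterPt (δ t) atTop fun l => f^[l] (δ t) := by
    intro l s t hs he
    have := hs.continuousAt_comp (h.continuous.iterate l).continuousAt
    rw [he] at this
    convert this using 2 with m
    rw [comp_apply, ← he, ← iterate_add_apply, ← iterate_add_apply, add_comm]
  by_cases hleft : ∃ u ∈ Ioo (0 : ℝ) 1, MapClusterPt (δ u) atTop (fun l => f^[l] (δ u)) ∧
      ∀ a < u, ∀ N : ℕ, ∃ l > N, ∃ s ∈ Ioo (0 : ℝ) 1, a < s ∧ s < u ∧ f^[l] (δ u) = δ s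
  · obtain ⟨u, hu, hur, hul⟩ := hleft
    obtain ⟨l₁, hl₁, s₁, hs₁, -, hsu₁, he₁⟩ := hul 0 hu.1 0
    obtain ⟨l₂, hl₂, s₂, hs₂, hss, hsu₂, he₂⟩ := hul s₁ hsu₁ l₁
    refine h.false_of_returns hl₁ (Nat.sub_pos_of_lt hl₂) hs₁.1 hss hsu₂ hu.2 he₁ ?_ hur
    rw [← he₁, ← iterate_add_apply, Nat.sub_add_cancel hl₂.le, he₂]
  · push Not at hleft
    have hright : ∀ u ∈ Ioo (0 : ℝ) 1, MapClusterPt (δ u) atTop (fun l => f^[l] (δ u)) →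
        ∀ b > u, ∀ N : ℕ, ∃ l > N, ∃ s ∈ Ioo (0 : ℝ) 1, u < s ∧ s < b ∧ f^[l] (δ u) = δ s := by
      intro u hu hur b hb N
      obtain ⟨a, ha, M, hM⟩ := hleft u hu hur
      obtain ⟨l, hl, s, hs, has, hsb, hne, he⟩ := h.exists_return hu ha hb hur (max M N)
      refine ⟨l, (le_max_right _ _).trans_lt hl, s, hs, ?_, hsb, he⟩
      refine lt_of_le_of_ne (not_lt.1 fun hsu => ?_) hne.symm
      exact hM l ((le_max_left _ _).trans_lt hl) s hs has hsu he
    obtain ⟨l₁, -, s₁, hs₁, hz₁, -, he₁⟩ := hright z hz hrec 1 hz.2 0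
    obtain ⟨l₂, hl₂, s₂, hs₂, hz₂, h21, he₂⟩ := hright z hz hrec s₁ hz₁ l₁
    obtain ⟨l₃, hl₃, s₃, hs₃, h23, h31, he₃⟩ := hright s₂ hs₂ (hiter hrec he₂) s₁ h21 0
    refine h.false_of_returns (Nat.sub_pos_of_lt hl₂) hl₃ hs₂.1 h23 h31 hs₁.2 ?_ he₃
      (hiter hrec he₁)
    rw [← he₁, ← iterate_add_apply, Nat.sub_add_cancel hl₂.le, he₂]

end IsAperiodicArc

/-- A recurrent point with finite orbit is periodic. -/
theorem mem_periodicPts_of_mem_recurrentPts {G : Type*} [TopologicalSpace G] [T1Space G]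
    {f : G → G} {x : G} (hx : x ∈ recurrentPts f) (hfin : x ∈ evPeriodicPts f) :
    x ∈ periodicPts f := by
  have h1 : (range fun n : ℕ => f^[n + 1] x).Finite :=
    Set.Finite.subset hfin (by rintro _ ⟨n, rfl⟩; exact ⟨n + 1, rfl⟩)
  have h2 : x ∈ closure (range fun n : ℕ => f^[n + 1] x) := mem_iInter.1 hx 1
  rw [h1.isClosed.closure_eq] at h2
  obtain ⟨n, hn⟩ := h2
  exact ⟨n + 1, n.succ_pos, hn⟩

/-- A recurrent point is a cluster point of its own orbit. -/
theorem mapClusterPt_of_mem_recurrentPts {G : Type*} [TopologicalSpace G]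
    {f : G → G} {x : G} (hx : x ∈ recurrentPts f) :
    MapClusterPt x atTop fun l => f^[l] x := by
  rw [mapClusterPt_atTop_iff_forall_mem_closure]
  intro i
  refine closure_mono ?_ (mem_iInter.1 hx i)
  rintro _ ⟨n, rfl⟩
  exact ⟨n + i, Nat.le_add_left i n, rfl⟩


/-- let `A = [x,y]` be an arc in `G` (parametrized by `γ`, with
`(x,y) = γ '' {t | 0 < t < 1}`). If `(x,y) ∩ (V(G) ∪ P(f)) = ∅` and
`(x,y) ∩ R(f) ≠ ∅`, then `A ∩ EP(f) = ∅`. -/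
theorem arc_no_eventually_periodic {G : Type*} [MetricSpace G] (V : Set G)
    (hG : IsTopGraph V) (f : G → G) (hf : Continuous f)
    (γ : unitInterval → G) (hγc : Continuous γ) (hγi : Function.Injective γ)
    (h1 : γ '' {t : unitInterval | 0 < t ∧ t < 1} ∩ (V ∪ Function.periodicPts f) = ∅)
    (h2 : (γ '' {t : unitInterval | 0 < t ∧ t < 1} ∩ recurrentPts f).Nonempty) :
    Set.range γ ∩ evPeriodicPts f = ∅ := by
  rw [← disjoint_iff_inter_eq_empty, Set.disjoint_left]
  rintro _ ⟨w, rfl⟩ hw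
  obtain ⟨_, ⟨z, ⟨hz0, hz1⟩, rfl⟩, hzR⟩ := h2
  have hz0' : (0 : ℝ) < z := hz0
  have hz1' : (z : ℝ) < 1 := hz1
  have hzV : ∀ t : unitInterval, (0 : ℝ) < t → (t : ℝ) < 1 → γ t ∈ Vᶜ ∧ γ t ∉ periodicPts f := by
    intro t ht0 ht1
    have h3 : γ t ∉ V ∪ periodicPts f := fun h3 =>
      (h1.subset ⟨mem_image_of_mem γ ⟨ht0, ht1⟩, h3⟩ : γ t ∈ (∅ : Set G))
    exact ⟨fun h4 => h3 (Or.inl h4), fun h4 => h3 (Or.inr h4)⟩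
  set O : Set G := range fun n : ℕ => f^[n] (γ w) with hO
  have hOinv : ∀ x ∈ O, ∀ k, f^[k] x ∈ O := by
    rintro _ ⟨n, rfl⟩ k
    exact ⟨k + n, iterate_add_apply f k n _⟩
  have hOfin : O.Finite := hw
  have hzO : γ z ∉ O := fun hz =>
    (hzV z hz0' hz1').2 (mem_periodicPts_of_mem_recurrentPts hzR (hOfin.subset (by
      rintro _ ⟨k, rfl⟩; exact hOinv _ hz k)))
  -- the point of `O` on the arc nearest to `z`
  obtain ⟨α, hαO, hαmin⟩ := (hOfin.preimage hγi.injOn).exists_minimalFor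
    (fun t : unitInterval => |(t : ℝ) - z|) (γ ⁻¹' O) ⟨w, ⟨0, rfl⟩⟩
  have hmin : ∀ t : unitInterval, |(t : ℝ) - z| < |(α : ℝ) - z| → γ t ∉ O := fun t ht htO =>
    absurd (hαmin htO ht.le) (not_le.2 ht)
  have hαz : (α : ℝ) ≠ z := fun h3 => hzO (Subtype.ext h3 ▸ hαO)
  have hα0 := α.2.1
  have hα1 := α.2.2
  obtain ⟨η, hη0, hη1, hβ0, hβ1⟩ : ∃ η : ℝ, 0 < η ∧ η < 1 ∧ 0 < z + η * (z - α) ∧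
      z + η * (z - α) < 1 := by
    refine ⟨min (z : ℝ) (1 - z) / 2, ?_, ?_, ?_, ?_⟩
    · have : 0 < min (z : ℝ) (1 - z) := lt_min hz0' (by linarith)
      linarith
    · have := min_le_left (z : ℝ) (1 - z)
      linarith
    all_goals
      have h3 : 0 < min (z : ℝ) (1 - z) := lt_min hz0' (by linarith)
      have h4 := min_le_left (z : ℝ) (1 - z)
      have h5 := min_le_right (z : ℝ) (1 - z)
      nlinarith
  set p : ℝ → ℝ := fun t => α + t * ((1 + η) * (z - α)) with hp
  have hpc : Continuous p := by fun_prop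
  have hpmem : ∀ t ∈ Icc (0 : ℝ) 1, p t ∈ Icc (0 : ℝ) 1 := by
    rintro t ⟨ht0, ht1⟩
    have h3 : p t = (1 - t) * α + t * (z + η * (z - α)) := by simp only [hp]; ring
    rw [h3]
    constructor <;> nlinarith
  have hpmem' : ∀ t ∈ Ioo (0 : ℝ) 1, p t ∈ Ioo (0 : ℝ) 1 := by
    rintro t ⟨ht0, ht1⟩
    have h3 : p t = (1 - t) * α + t * (z + η * (z - α)) := by simp only [hp]; ring
    rw [h3]
    constructor <;> nlinarith
  have hpinj : Injective p := by
    intro s t hst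
    have h3 : (1 + η) * (z - α : ℝ) ≠ 0 :=
      mul_ne_zero (by linarith) (sub_ne_zero.2 (Ne.symm hαz))
    exact mul_right_cancel₀ h3 (add_left_cancel hst)
  have hpdist : ∀ t ∈ Ioo (0 : ℝ) 1, |p t - z| < |(α : ℝ) - z| := by
    rintro t ⟨ht0, ht1⟩
    have h3 : p t - z = (α - z) * (1 - t * (1 + η)) := by simp only [hp]; ring
    rw [h3, abs_mul]
    refine mul_lt_of_lt_one_right (abs_pos.2 (sub_ne_zero.2 hαz)) (abs_lt.2 ⟨?_, ?_⟩) <;> nlinarith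
  set δ : ℝ → G := fun t => γ (projIcc 0 1 zero_le_one (p t)) with hδ
  have hδc : Continuous δ := hγc.comp (continuous_projIcc.comp hpc)
  have hproj : ∀ t ∈ Icc (0 : ℝ) 1, ((projIcc 0 1 zero_le_one (p t) : unitInterval) : ℝ) = p t :=
    fun t ht => by rw [projIcc_of_mem _ (hpmem t ht)]
  have hδi : InjOn δ (Icc 0 1) := by
    intro s hs t ht hst
    have h3 := congrArg Subtype.val (hγi hst)
    rw [hproj s hs, hproj t ht] at h3
    exact hpinj h3
  have hδV : ∀ t ∈ Ioo (0 : ℝ) 1, δ t ∈ Vᶜ ∧ δ t ∉ periodicPts f := fun t ht =>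
    hzV _ (by rw [hproj t (Ioo_subset_Icc_self ht)]; exact (hpmem' t ht).1)
      (by rw [hproj t (Ioo_subset_Icc_self ht)]; exact (hpmem' t ht).2)
  have hδO : ∀ t ∈ Ioo (0 : ℝ) 1, δ t ∉ O := fun t ht =>
    hmin _ (by rw [hproj t (Ioo_subset_Icc_self ht)]; exact hpdist t ht)
  have hδ0 : δ 0 = γ α := by simp [hδ, hp]
  have ht : 1 / (1 + η) ∈ Ioo (0 : ℝ) 1 :=
    ⟨by positivity, (div_lt_one (by linarith)).2 (by linarith)⟩
  have hδz : δ (1 / (1 + η)) = γ z := by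
    refine congrArg γ (Subtype.ext ?_)
    rw [hproj _ (Ioo_subset_Icc_self ht)]
    simp only [hp]
    field_simp
    ring
  have hsub : MapsTo δ (Ioo 0 1) (connectedComponentIn Vᶜ (γ z)) := by
    rw [mapsTo_iff_image_subset]
    exact (isPreconnected_Ioo.image δ hδc.continuousOn).subset_connectedComponentIn
      ⟨_, ht, hδz⟩ (image_subset_iff.2 fun t ht => (hδV t ht).1)
  have harc : IsAperiodicArc f δ :=
    { continuous := hf
      continuousOn := hδc.continuousOn
      injOn := hδi
      isOpen := isOpen_image_Ioo_of_subset_openArc (isOpen_edge hG (γ z))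
        (hG.component_openArc _ (hzV z hz0' hz1').1) hδc.continuousOn
        (hδi.mono Ioo_subset_Icc_self) hsub
      notMem_periodicPts := fun t ht => (hδV t ht).2
      iterate_notMem := by
        rintro k ⟨t, ht, hk⟩
        exact hδO t ht (hk ▸ hδ0 ▸ hOinv _ hαO k) }
  refine harc.not_recurrent ht ?_
  rw [hδz]
  exact mapClusterPt_of_mem_recurrentPts hzR
end

section
/- Let f : G → G be a graph map and let X and Y be component-cyclic f-invariant subsets of G. If X ∩ Y ≠ ∅, then X ∪ Y is also a component-cyclic f-invariant set. -/
open Set Function Filter Topology Metric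

/-- The component of `x` in an invariant set is mapped into the component of `f x`. -/
theorem image_connectedComponentIn_subset_of_mapsTo {G : Type*} [TopologicalSpace G]
    {f : G → G} (hf : Continuous f) {Z : Set G} (hZ : MapsTo f Z Z) {x : G} (hx : x ∈ Z) :
    f '' connectedComponentIn Z x ⊆ connectedComponentIn Z (f x) :=
  (isPreconnected_connectedComponentIn.image f hf.continuousOn).subset_connectedComponentIn
    (mem_image_of_mem f (mem_connectedComponentIn hx))
    ((image_mono (connectedComponentIn_subset Z x)).trans hZ.image_subset)

theorem connectedComponentIn_eq_of_subset {G : Type*} [TopologicalSpace G] {X Z : Set G}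
    (h : X ⊆ Z) {x y : G} (hy : y ∈ X)
    (hxy : connectedComponentIn X x = connectedComponentIn X y) :
    connectedComponentIn Z x = connectedComponentIn Z y :=
  connectedComponentIn_eq
    (connectedComponentIn_mono x h (hxy ▸ mem_connectedComponentIn hy))

theorem ComponentCyclic.mapsTo {G : Type*} [TopologicalSpace G] {f : G → G} {X : Set G}
    (hX : ComponentCyclic f X) : MapsTo f X X := by
  obtain ⟨k, C, -, rfl, -, -, -, hC⟩ := hX
  intro x hx
  obtain ⟨i, hi⟩ := mem_iUnion.1 hx
  exact mem_iUnion.2 ⟨_, hC i (mem_image_of_mem f hi)⟩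

/-- The forward orbit of any point of a component-cyclic set visits every component at a
positive time. -/
theorem ComponentCyclic.exists_iterate {G : Type*} [TopologicalSpace G] {f : G → G}
    {X : Set G} (hX : ComponentCyclic f X) {p x : G} (hp : p ∈ X) (hx : x ∈ X) :
    ∃ n, 0 < n ∧ connectedComponentIn X (f^[n] p) = connectedComponentIn X x := by
  obtain ⟨k, C, hk, rfl, -, hcomp, -, hC⟩ := hX
  obtain ⟨i, hi⟩ := mem_iUnion.1 hp
  obtain ⟨j, hj⟩ := mem_iUnion.1 hx
  have key : ∀ n, f^[n] p ∈ C ⟨(i.1 + n) % k, Nat.mod_lt _ hk⟩ := by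
    intro n
    induction n with
    | zero => simpa [Nat.mod_eq_of_lt i.2] using hi
    | succ n ih =>
      rw [iterate_succ_apply']
      have h := hC _ (mem_image_of_mem f ih)
      simpa [finSucc, Nat.mod_add_mod, add_assoc] using h
  refine ⟨j.1 + k - i.1, by omega, ?_⟩
  have h := key (j.1 + k - i.1)
  have hmod : (i.1 + (j.1 + k - i.1)) % k = j.1 := by
    rw [show i.1 + (j.1 + k - i.1) = j.1 + k by omega, Nat.add_mod_right,
      Nat.mod_eq_of_lt j.2]
  simp only [hmod] at h
  rw [hcomp j _ h, hcomp j _ hj]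

/-- An invariant set is component-cyclic as soon as the forward orbit of one of its points
visits every component at a positive time. -/
theorem componentCyclic_of_exists_iterate {G : Type*} [TopologicalSpace G] {f : G → G}
    (hf : Continuous f) {Z : Set G} (hZ : MapsTo f Z Z) {p : G} (hp : p ∈ Z)
    (horb : ∀ x ∈ Z, ∃ n, 0 < n ∧
      connectedComponentIn Z (f^[n] p) = connectedComponentIn Z x) :
    ComponentCyclic f Z := by
  classical
  have hmem : ∀ n, f^[n] p ∈ Z := fun n => hZ.iterate n hp
  let c : ℕ → Set G := fun n => connectedComponentIn Z (f^[n] p)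
  have himg : ∀ n, f '' c n ⊆ c (n + 1) := by
    intro n
    simp only [c, iterate_succ_apply']
    exact image_connectedComponentIn_subset_of_mapsTo hf hZ (hmem n)
  have hstep : ∀ m n, c m = c n → c (m + 1) = c (n + 1) := by
    intro m n h
    have h₁ : f^[m] p ∈ c n := h ▸ mem_connectedComponentIn (hmem m)
    have h₂ := himg n (mem_image_of_mem f h₁)
    rw [← iterate_succ_apply' f] at h₂
    exact (connectedComponentIn_eq h₂).symm
  have hshift : ∀ m n d, c m = c n → c (m + d) = c (n + d) := by
    intro m n d h
    induction d with
    | zero => exact h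
    | succ d ih => exact hstep _ _ ih
  have hex : ∃ n, 0 < n ∧ c n = c 0 := horb p hp
  obtain ⟨N, ⟨hN, hN0⟩, hmin⟩ : ∃ N, (0 < N ∧ c N = c 0) ∧ ∀ m < N, ¬(0 < m ∧ c m = c 0) :=
    ⟨Nat.find hex, Nat.find_spec hex, fun _ => Nat.find_min hex⟩
  have hper : ∀ q r, c (r + N * q) = c r := by
    intro q r
    induction q with
    | zero => rfl
    | succ q ih =>
      have h := hshift N 0 (r + N * q) hN0
      rw [zero_add, ih] at h
      rw [← h]
      congr 1
      ring
  have hmod : ∀ m, c (m % N) = c m := by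
    intro m
    conv_rhs => rw [← Nat.mod_add_div m N]
    exact (hper _ _).symm
  have hne : ∀ i j, i < j → j < N → c i ≠ c j := by
    intro i j hij hj h
    have h' := hshift i j (N - j) h
    rw [Nat.add_sub_cancel' hj.le, hN0] at h'
    exact hmin _ (by omega) ⟨by omega, h'⟩
  refine ⟨N, fun i => c i, hN, ?_, fun i => ⟨_, mem_connectedComponentIn (hmem i)⟩,
    fun i x hx => (connectedComponentIn_eq hx).symm, ?_, ?_⟩
  · refine Subset.antisymm (iUnion_subset fun i => connectedComponentIn_subset _ _) ?_
    intro x hx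
    obtain ⟨n, -, hn⟩ := horb x hx
    refine mem_iUnion.2 ⟨⟨n % N, Nat.mod_lt _ hN⟩, ?_⟩
    change x ∈ c (n % N)
    rw [hmod]
    change x ∈ connectedComponentIn Z (f^[n] p)
    rw [hn]
    exact mem_connectedComponentIn hx
  · intro i j hij
    rcases lt_trichotomy i.1 j.1 with h | h | h
    · exact absurd hij (hne _ _ h j.2)
    · exact Fin.ext h
    · exact absurd hij.symm (hne _ _ h i.2)
  · intro i
    change f '' c i ⊆ c ((i.1 + 1) % N)
    rw [hmod]
    exact himg i

/-- if `X` and `Y` are component-cyclic `f`-invariant sets with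
`X ∩ Y ≠ ∅`, then `X ∪ Y` is a component-cyclic `f`-invariant set. -/
theorem componentCyclic_union {G : Type*} [MetricSpace G] (V : Set G)
    (hG : IsTopGraph V) (f : G → G) (hf : Continuous f) (X Y : Set G)
    (hX : ComponentCyclic f X) (hY : ComponentCyclic f Y)
    (hmeet : (X ∩ Y).Nonempty) :
    ComponentCyclic f (X ∪ Y) := by
  obtain ⟨p, hpX, hpY⟩ := hmeet
  refine componentCyclic_of_exists_iterate hf (hX.mapsTo.union_union hY.mapsTo)
    (Or.inl hpX) ?_
  rintro x (hx | hx)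
  · obtain ⟨n, hn, h⟩ := hX.exists_iterate hpX hx
    exact ⟨n, hn, connectedComponentIn_eq_of_subset subset_union_left hx h⟩
  · obtain ⟨n, hn, h⟩ := hY.exists_iterate hpY hx
    exact ⟨n, hn, connectedComponentIn_eq_of_subset subset_union_right hx h⟩
end

section
/- Let f : G → G be a graph map. Then for every x ∈ R(f) − cl(P(f)) there exists a component-cyclic f-invariant closed set Y such that x ∈ Y ⊆ G − EP(f). -/
open Set Function Filter Topology Metric

section ComponentCyclic

variable {G : Type*} [TopologicalSpace G]

/-- A set covered by a periodic sequence of nonempty connected sets, each mapped into the next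
one, is component-cyclic. -/
theorem componentCyclic_of_periodic_cover {f : G → G} (hf : Continuous f) {X : Set G}
    {S : ℕ → Set G} {m : ℕ} (hm : 0 < m) (hper : ∀ n, S (n + m) = S n)
    (hpre : ∀ n, IsPreconnected (S n)) (hne : ∀ n, (S n).Nonempty) (hX : ⋃ n, S n = X)
    (hmap : ∀ n, MapsTo f (S n) (S (n + 1))) : ComponentCyclic f X := by
  classical
  choose s hs using hne
  have hSX : ∀ n, S n ⊆ X := fun n => hX ▸ subset_iUnion S n
  have hfX : MapsTo f X X := by
    intro x hx
    rw [← hX] at hx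
    obtain ⟨n, hn⟩ := mem_iUnion.1 hx
    exact hSX (n + 1) (hmap n hn)
  set D : ℕ → Set G := fun n => connectedComponentIn X (s n) with hD
  have hDX : ∀ n, D n ⊆ X := fun n => connectedComponentIn_subset X (s n)
  have hSD : ∀ n, S n ⊆ D n := fun n =>
    (hpre n).subset_connectedComponentIn (hs n) (hSX n)
  have hDeq : ∀ n, ∀ x ∈ D n, connectedComponentIn X x = D n := fun n x hx =>
    (connectedComponentIn_eq hx).symm
  have hDper : ∀ n, D (n + m) = D n := fun n => by
    have : s (n + m) ∈ D n := hSD n (hper n ▸ hs (n + m))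
    exact hDeq n _ this
  have hmapD : ∀ i, f '' D i ⊆ D (i + 1) := fun i => by
    have h1 : IsPreconnected (f '' D i) :=
      isPreconnected_connectedComponentIn.image f hf.continuousOn
    have h2 : f '' D i ⊆ X := image_subset_iff.2 fun x hx => hfX (hDX i hx)
    have h3 := h1.subset_connectedComponentIn (mem_image_of_mem f (hSD i (hs i))) h2
    rwa [hDeq (i + 1) _ (hSD _ (hmap i (hs i)))] at h3
  have hstep : ∀ i j, D i = D j → D (i + 1) = D (j + 1) := by
    intro i j hij
    have h1 : f (s i) ∈ D (i + 1) := hmapD i (mem_image_of_mem f (hSD i (hs i)))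
    have h2 : f (s i) ∈ D (j + 1) := hmapD j (mem_image_of_mem f (hij ▸ hSD i (hs i)))
    rw [← hDeq _ _ h1, ← hDeq _ _ h2]
  have hshift : ∀ i j r, D i = D j → D (i + r) = D (j + r) := by
    intro i j r h
    induction r with
    | zero => exact h
    | succ r ih => exact hstep _ _ ih
  have hex : ∃ k, 0 < k ∧ D k = D 0 := ⟨m, hm, by simpa using hDper 0⟩
  set k := Nat.find hex with hk
  obtain ⟨hk0, hkD⟩ := Nat.find_spec hex
  have hkmin : ∀ j, 0 < j → j < k → D j ≠ D 0 := fun j hj hjk h =>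
    Nat.find_min hex hjk ⟨hj, h⟩
  have hkper : ∀ n, D (n + k) = D n := fun n => by
    simpa [add_comm] using hshift k 0 n hkD
  have hmod : ∀ n, D (n % k) = D n := by
    intro n
    induction n using Nat.strong_induction_on with
    | _ n ih =>
      rcases lt_or_ge n k with h | h
      · rw [Nat.mod_eq_of_lt h]
      · obtain ⟨r, rfl⟩ := Nat.exists_eq_add_of_le' h
        rw [Nat.add_mod_right, hkper, ih r (by omega)]
  have hmper : ∀ q n, D (n + m * q) = D n := by
    intro q n
    induction q with
    | zero => simp
    | succ q ih => rw [Nat.mul_succ, ← add_assoc, hDper, ih]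
  have hinj : ∀ i j, i < j → j < k → D i ≠ D j := by
    intro i j hij hjk h
    refine hkmin (j - i) (by omega) (by omega) ?_
    have h1 := hshift i j (m * i - i) h
    have hle : i ≤ m * i := Nat.le_mul_of_pos_left i hm
    rw [show i + (m * i - i) = 0 + m * i by omega, hmper,
      show j + (m * i - i) = (j - i) + m * i by omega, hmper] at h1
    exact h1.symm
  refine ⟨k, fun i => D i, hk0, ?_, fun i => ⟨s i, hSD i (hs i)⟩, fun i => hDeq i, ?_, ?_⟩
  · refine Subset.antisymm (iUnion_subset fun i : Fin k => hDX i) ?_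
    rw [← hX]
    refine iUnion_subset fun n => (hSD n).trans ?_
    rw [← hmod n]
    exact subset_iUnion (fun i : Fin k => D i) ⟨n % k, Nat.mod_lt _ hk0⟩
  · intro i j hij
    by_contra hne
    rcases lt_or_gt_of_ne (fun h => hne (Fin.ext h)) with h | h
    · exact hinj _ _ h j.2 hij
    · exact hinj _ _ h i.2 hij.symm
  · intro i
    change f '' D i ⊆ D ((i.1 + 1) % k)
    rw [hmod]
    exact hmapD i

end ComponentCyclic

theorem mapsTo_periodicPts {G : Type*} {f : G → G} : MapsTo f (periodicPts f) (periodicPts f) := by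
  rintro x ⟨n, hn, h⟩
  exact ⟨n, hn, h.apply⟩

section Recurrence

variable {G : Type*} [TopologicalSpace G] {f : G → G} {x : G}

theorem mem_recurrentPts_iff :
    x ∈ recurrentPts f ↔ ∀ U ∈ 𝓝 x, ∀ N : ℕ, ∃ n ≥ N, f^[n] x ∈ U := by
  simp only [recurrentPts, omegaSet, mem_ofPred_eq, mem_iInter, mem_closure_iff_nhds]
  constructor
  · intro h U hU N
    obtain ⟨_, hy, n, rfl⟩ := h N U hU
    exact ⟨n + N, by omega, hy⟩
  · intro h N U hU
    obtain ⟨n, hn, hnU⟩ := h U hU N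
    exact ⟨f^[n] x, hnU, n - N, by simp only [Nat.sub_add_cancel hn]⟩

theorem iterate_mem_recurrentPts (hf : Continuous f) (hx : x ∈ recurrentPts f) (l : ℕ) :
    f^[l] x ∈ recurrentPts f := by
  rw [mem_recurrentPts_iff] at hx ⊢
  intro U hU N
  obtain ⟨n, hn, hnU⟩ := hx _ ((hf.iterate l).continuousAt hU) N
  refine ⟨n, hn, ?_⟩
  rw [← iterate_add_apply, add_comm, iterate_add_apply]
  exact hnU

theorem mem_closure_orbit_of_recurrent (hx : x ∈ recurrentPts f) (l : ℕ) :
    x ∈ closure (range fun n : ℕ => f^[n] (f^[l] x)) := by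
  have := mem_iInter.1 hx l
  simpa only [iterate_add_apply] using this

end Recurrence

section ArcDynamics

/-- A continuous function descending from above `v` to below `u` has a subinterval which it
maps into `[u, v]`, with the endpoints going to `v` and `u`. -/
theorem exists_descending_subinterval {h : ℝ → ℝ} {a b u v : ℝ} (hab : a ≤ b)
    (hc : ContinuousOn h (Icc a b)) (ha : v ≤ h a) (hb : h b ≤ u) (huv : u < v) :
    ∃ a' b', a ≤ a' ∧ a' ≤ b' ∧ b' ≤ b ∧ h a' = v ∧ h b' = u ∧
      ∀ s ∈ Icc a' b', h s ∈ Icc u v := by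
  obtain ⟨b', ⟨hb'I, hb'u⟩, hb'min⟩ : ∃ b', IsLeast (Icc a b ∩ h ⁻¹' Iic u) b' :=
    (isCompact_Icc.of_isClosed_subset (hc.preimage_isClosed_of_isClosed isClosed_Icc isClosed_Iic)
      inter_subset_left).exists_isLeast ⟨b, right_mem_Icc.2 hab, hb⟩
  have hc' : ContinuousOn h (Icc a b') := hc.mono (Icc_subset_Icc_right hb'I.2)
  have hb'eq : h b' = u := by
    obtain ⟨s, hs, hsu⟩ := intermediate_value_Icc' hb'I.1 hc' ⟨hb'u, huv.le.trans ha⟩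
    have : b' ≤ s := hb'min ⟨⟨hs.1, hs.2.trans hb'I.2⟩, hsu.le⟩
    rwa [le_antisymm hs.2 this] at hsu
  obtain ⟨a', ⟨ha'I, ha'v⟩, ha'max⟩ : ∃ a', IsGreatest (Icc a b' ∩ h ⁻¹' Ici v) a' :=
    (isCompact_Icc.of_isClosed_subset
      (hc'.preimage_isClosed_of_isClosed isClosed_Icc isClosed_Ici)
      inter_subset_left).exists_isGreatest ⟨a, left_mem_Icc.2 hb'I.1, ha⟩
  have ha'eq : h a' = v := by
    obtain ⟨s, hs, hsv⟩ := intermediate_value_Icc' ha'I.2 (hc'.mono (Icc_subset_Icc_left ha'I.1))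
      ⟨hb'eq.trans_le huv.le, ha'v⟩
    have : s ≤ a' := ha'max ⟨⟨ha'I.1.trans hs.1, hs.2⟩, hsv.ge⟩
    rwa [le_antisymm this hs.1] at hsv
  refine ⟨a', b', ha'I.1, ha'I.2, hb'I.2, ha'eq, hb'eq, fun s hs => ⟨?_, ?_⟩⟩
  · by_contra! hlt
    have : b' ≤ s := hb'min ⟨⟨ha'I.1.trans hs.1, hs.2.trans hb'I.2⟩, hlt.le⟩
    rw [le_antisymm hs.2 this, hb'eq] at hlt
    exact lt_irrefl _ hlt
  · by_contra! hlt
    have : s ≤ a' := ha'max ⟨⟨ha'I.1.trans hs.1, hs.2⟩, hlt.le⟩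
    rw [le_antisymm this hs.1, ha'eq] at hlt
    exact lt_irrefl _ hlt

/-- In an arc without periodic points, an iterate read in the arc has no fixed point. -/
theorem not_crossing_of_no_periodicPts {G : Type*} {φ : ℝ → G} {f : G → G}
    (hP : ∀ t, φ t ∉ periodicPts f) {n : ℕ} (hn : 0 < n)
    {h : ℝ → ℝ} {a b : ℝ} (hc : ContinuousOn h (uIcc a b))
    (hh : ∀ s ∈ uIcc a b, φ (h s) = f^[n] (φ s)) (ha : a ≤ h a) (hb : h b ≤ b) : False := by
  obtain ⟨c, hc, hfix⟩ := exists_mem_uIcc_isFixedPt hc ha hb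
  refine hP c ⟨n, hn, ?_⟩
  rw [IsPeriodicPt, Function.IsFixedPt, ← hh c hc, hfix]

variable {G : Type*} [TopologicalSpace G] {φ : ℝ → G}

/-- A path starting at `φ a` and leaving an open arc `φ` has an initial segment which, read in
the arc, ends at one of two prescribed parameters around `a`. -/
theorem exists_first_exit [T2Space G] (hφ : IsOpenEmbedding φ) {g : ℝ → G} {z y α β a : ℝ}
    (hzy : z ≤ y) (hg : ContinuousOn g (Icc z y)) (hz : g z = φ a) (ha : a ∈ Ioo α β)
    (hy : g y ∉ range φ) :
    ∃ t ∈ Icc z y, ∃ h : ℝ → ℝ, ContinuousOn h (Icc z t) ∧ (∀ s ∈ Icc z t, φ (h s) = g s) ∧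
      h z = a ∧ (h t = α ∨ h t = β) := by
  have hopen : IsOpen (φ '' Ioo α β) := hφ.isOpenMap _ isOpen_Ioo
  have hclosed : IsClosed (φ '' Icc α β) := (isCompact_Icc.image hφ.continuous).isClosed
  obtain ⟨t, ⟨htI, htn⟩, htmin⟩ : ∃ t, IsLeast (Icc z y ∩ g ⁻¹' (φ '' Ioo α β)ᶜ) t :=
    (isCompact_Icc.of_isClosed_subset
      (hg.preimage_isClosed_of_isClosed isClosed_Icc hopen.isClosed_compl)
      inter_subset_left).exists_isLeast
      ⟨y, right_mem_Icc.2 hzy, fun h => hy (image_subset_range _ _ h)⟩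
  have hzt : z ≠ t := by
    rintro rfl
    exact htn ⟨a, ha, hz.symm⟩
  have hgt : ContinuousOn g (Icc z t) := hg.mono (Icc_subset_Icc_right htI.2)
  have hbefore : MapsTo g (Ico z t) (φ '' Icc α β) := by
    intro s hs
    by_contra hns
    exact absurd (htmin ⟨⟨hs.1, hs.2.le.trans htI.2⟩,
      fun h => hns (image_mono Ioo_subset_Icc_self h)⟩) (not_le.2 hs.2)
  have hall : MapsTo g (Icc z t) (φ '' Icc α β) := by
    have := hbefore.closure_of_continuousOn (by rwa [closure_Ico hzt])
    rwa [closure_Ico hzt, hclosed.closure_eq] at this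
  have hinv : ∀ s ∈ Icc z t, φ (Function.invFun φ (g s)) = g s := fun s hs =>
    Function.invFun_eq (by obtain ⟨r, -, hr⟩ := hall hs; exact ⟨r, hr⟩)
  have hleft : LeftInverse (Function.invFun φ) φ := Function.leftInverse_invFun hφ.injective
  refine ⟨t, htI, fun s => Function.invFun φ (g s), ?_, hinv, ?_, ?_⟩
  · rw [hφ.isInducing.continuousOn_iff]
    exact hgt.congr hinv
  · simp only [hz, hleft a]
  · obtain ⟨r, hr, hrt⟩ := hall (right_mem_Icc.2 htI.1)
    have hrn : r ∉ Ioo α β := fun h => htn ⟨r, h, hrt⟩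
    simp only [← hrt, hleft r]
    rcases eq_or_lt_of_le hr.1 with h | h
    · exact Or.inl h.symm
    · exact Or.inr (le_antisymm hr.2 (not_lt.1 fun h' => hrn ⟨h, h'⟩))

variable {f : G → G}

theorem false_of_escape_on_both_sides_of_right_recurrent [T2Space G] (hf : Continuous f)
    (hφ : IsOpenEmbedding φ) (hP : ∀ t, φ t ∉ periodicPts f) {t₀ c y : ℝ}
    (hrec : ∀ ε > 0, ∀ N : ℕ, ∃ n ≥ N, ∃ t, t₀ < t ∧ t < t₀ + ε ∧ f^[n] (φ t₀) = φ t)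
    (hc : c < t₀) (hy : t₀ < y) (hcQ : ∀ᶠ n in atTop, f^[n] (φ c) ∉ range φ)
    (hyQ : ∀ᶠ n in atTop, f^[n] (φ y) ∉ range φ) : False := by
  obtain ⟨Nc, hNc⟩ := eventually_atTop.1 hcQ
  obtain ⟨Ny, hNy⟩ := eventually_atTop.1 hyQ
  have hcont : ∀ n, Continuous fun t => f^[n] (φ t) := fun n => (hf.iterate n).comp hφ.continuous
  obtain ⟨n₁, -, z, hz0, hzy, hz⟩ := hrec (y - t₀) (by linarith) 0
  obtain ⟨n₂, hn₂, t₂, ht₂0, ht₂z, ht₂⟩ := hrec (z - t₀) (by linarith) (n₁ + 1 + Ny)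
  obtain ⟨n₃, hn₃, t₃, ht₃0, ht₃z, ht₃⟩ := hrec (z - t₀) (by linarith) (1 + Nc)
  obtain ⟨r, rfl⟩ : ∃ r, n₂ = r + n₁ := ⟨n₂ - n₁, by omega⟩
  have hr : f^[r] (φ z) = φ t₂ := by rw [← hz, ← iterate_add_apply, ht₂]
  obtain ⟨t, htI, h, hhc, hhφ, hhz, hht⟩ := exists_first_exit hφ (α := c - 1) (β := y + 1)
    (a := t₂) (by linarith : z ≤ y) (hcont r).continuousOn hr
    ⟨by linarith, by linarith⟩ (hNy r (by omega))
  have hht : h t = c - 1 := by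
    rcases hht with hht | hht
    · exact hht
    · exfalso
      have hu : uIcc t z = Icc z t := uIcc_of_ge htI.1
      refine not_crossing_of_no_periodicPts hP (n := r) (a := t) (b := z) (by omega) (hu ▸ hhc)
        (hu ▸ hhφ) ?_ ?_
      · linarith [htI.2]
      · linarith
  obtain ⟨t', ht'I, k', hkc', hkφ', hkz', hkt'⟩ := exists_first_exit hφ (α := c - 1)
    (β := y + 1) (a := t₃) (g := fun s => f^[n₃] (φ (-s))) (neg_le_neg hc.le)
    ((hcont n₃).comp continuous_neg).continuousOn (by simpa using ht₃)
    ⟨by linarith, by linarith⟩ (by simpa using hNc n₃ (by omega))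
  obtain ⟨s₀, rfl⟩ : ∃ s₀, t' = -s₀ := ⟨-t', by simp⟩
  set k : ℝ → ℝ := fun s => k' (-s) with hk
  have hneg : ∀ s ∈ Icc s₀ t₀, -s ∈ Icc (-t₀) (-s₀) := fun s hs =>
    ⟨neg_le_neg hs.2, neg_le_neg hs.1⟩
  have hkc : ContinuousOn k (Icc s₀ t₀) := hkc'.comp continuous_neg.continuousOn hneg
  have hkφ : ∀ s ∈ Icc s₀ t₀, φ (k s) = f^[n₃] (φ s) := fun s hs => by
    simpa using hkφ' (-s) (hneg s hs)
  have hs₀c : c ≤ s₀ := neg_le_neg_iff.1 ht'I.2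
  have hs₀t : s₀ ≤ t₀ := neg_le_neg_iff.1 ht'I.1
  have hks₀ : k s₀ = y + 1 := by
    rcases hkt' with hkt' | hkt'
    · exfalso
      have hu : uIcc t₀ s₀ = Icc s₀ t₀ := uIcc_of_ge hs₀t
      refine not_crossing_of_no_periodicPts hP (n := n₃) (a := t₀) (b := s₀) (by omega)
        (hu ▸ hkc) (hu ▸ hkφ) ?_ ?_
      · change t₀ ≤ k' (-t₀)
        linarith
      · change k' (-s₀) ≤ s₀
        linarith
    · exact hkt'
  have hlt : s₀ < t₀ := by
    refine lt_of_le_of_ne hs₀t ?_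
    rintro rfl
    have : k s₀ = t₃ := hkz'
    linarith
  obtain ⟨a', b', haa', hab', hbb', hha', hhb', hmem⟩ := exists_descending_subinterval htI.1 hhc
    (u := s₀) (v := t₀) (by linarith) (by linarith) hlt
  have hsub : Icc a' b' ⊆ Icc z t := Icc_subset_Icc haa' hbb'
  have hu : uIcc b' a' = Icc a' b' := uIcc_of_ge hab'
  refine not_crossing_of_no_periodicPts hP (n := n₃ + r) (h := fun s => k (h s)) (a := b')
    (b := a') (by omega) ?_ ?_ ?_ ?_
  · rw [hu]
    exact hkc.comp (hhc.mono hsub) hmem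
  · rw [hu]
    intro s hs
    rw [hkφ _ (hmem s hs), hhφ s (hsub hs), iterate_add_apply]
  · simp only [hhb', hks₀]
    linarith [htI.2]
  · have : k t₀ = t₃ := hkz'
    simp only [hha', this]
    linarith

/-- In an open arc without periodic points, there cannot be points on both sides of a recurrent
point whose orbits eventually leave the arc forever. -/
theorem false_of_escape_on_both_sides [T2Space G] (hf : Continuous f)
    (hφ : IsOpenEmbedding φ) (hP : ∀ t, φ t ∉ periodicPts f) {t₀ c y : ℝ}
    (hrec : φ t₀ ∈ recurrentPts f)
    (hc : c < t₀) (hy : t₀ < y) (hcQ : ∀ᶠ n in atTop, f^[n] (φ c) ∉ range φ)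
    (hyQ : ∀ᶠ n in atTop, f^[n] (φ y) ∉ range φ) : False := by
  by_cases hright : ∀ ε > 0, ∀ N : ℕ, ∃ n ≥ N, ∃ t, t₀ < t ∧ t < t₀ + ε ∧ f^[n] (φ t₀) = φ t
  · exact false_of_escape_on_both_sides_of_right_recurrent hf hφ hP hright hc hy hcQ hyQ
  push Not at hright
  obtain ⟨δ, hδ, M, hM⟩ := hright
  have hrange : range (fun t => φ (-t)) = range φ := (Equiv.neg ℝ).surjective.range_comp φ
  refine false_of_escape_on_both_sides_of_right_recurrent (φ := fun t => φ (-t)) (t₀ := -t₀)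
    (c := -y) (y := -c) hf (hφ.comp (Homeomorph.neg ℝ).isOpenEmbedding) (fun t => hP _) ?_
    (by linarith) (by linarith) (by simpa only [hrange, neg_neg] using hyQ)
    (by simpa only [hrange, neg_neg] using hcQ)
  intro ε hε N
  have hU : φ '' Ioo (t₀ - min ε δ) (t₀ + min ε δ) ∈ 𝓝 (φ t₀) :=
    hφ.isOpenMap.image_mem_nhds (Ioo_mem_nhds (by simp [hε, hδ]) (by simp [hε, hδ]))
  obtain ⟨n, hn, t, ht, hnt⟩ := mem_recurrentPts_iff.1 hrec _ hU (max (max N M) 1)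
  have h1 := min_le_left ε δ
  have h2 := min_le_right ε δ
  have hne : t ≠ t₀ := by
    rintro rfl
    exact hP t ⟨n, lt_of_lt_of_le zero_lt_one ((le_max_right _ _).trans hn), hnt.symm⟩
  have hlt : t < t₀ := by
    by_contra! hge
    refine hM n ((le_max_right _ _).trans ((le_max_left _ _).trans hn)) t
      (lt_of_le_of_ne hge hne.symm) (by linarith [ht.2]) hnt.symm
  exact ⟨n, (le_max_left _ _).trans ((le_max_left _ _).trans hn), -t, by linarith,
    by linarith [ht.1], by simpa using hnt.symm⟩

/-- Around some point of a recurrent orbit in an arc without periodic points there is a compact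
subarc all of whose points visit the arc infinitely often. -/
theorem exists_subarc_frequently_mem [T2Space G] (hf : Continuous f)
    (hφ : IsOpenEmbedding φ) (hP : ∀ t, φ t ∉ periodicPts f) {t₀ : ℝ}
    (hrec : φ t₀ ∈ recurrentPts f) :
    ∃ α β t : ℝ, ∃ l : ℕ, α < t ∧ t < β ∧ f^[l] (φ t₀) = φ t ∧
      ∀ s ∈ Icc α β, ∃ᶠ n in atTop, f^[n] (φ s) ∈ range φ := by
  by_cases hQ : ∃ e, ∀ᶠ n in atTop, f^[n] (φ e) ∉ range φ
  · obtain ⟨e, he⟩ := hQ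
    have hne : e ≠ t₀ := by
      rintro rfl
      obtain ⟨N, hN⟩ := eventually_atTop.1 he
      obtain ⟨n, hn, hn'⟩ := mem_recurrentPts_iff.1 hrec _
        (hφ.isOpen_range.mem_nhds ⟨e, rfl⟩) N
      exact hN n hn hn'
    set d := |e - t₀| with hd
    have hd0 : 0 < d := abs_pos.2 (sub_ne_zero.2 hne)
    have hU : φ '' Ioo (t₀ - d) (t₀ + d) ∈ 𝓝 (φ t₀) :=
      hφ.isOpenMap.image_mem_nhds (Ioo_mem_nhds (by linarith) (by linarith))
    obtain ⟨n, hn, t, ht, hnt⟩ := mem_recurrentPts_iff.1 hrec _ hU 1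
    have htne : t ≠ t₀ := by
      rintro rfl
      exact hP t ⟨n, hn, hnt.symm⟩
    have hrect : φ t ∈ recurrentPts f := hnt ▸ iterate_mem_recurrentPts hf hrec n
    have hside : ∀ {s s' : ℝ}, φ s' ∈ recurrentPts f → (s < s' ∧ s' < e ∨ e < s' ∧ s' < s) →
        ∃ᶠ n in atTop, f^[n] (φ s) ∈ range φ := by
      intro s s' hs' hss hev
      have hev' : ∀ᶠ n in atTop, f^[n] (φ s) ∉ range φ := hev
      rcases hss with ⟨h1, h2⟩ | ⟨h1, h2⟩
      · exact false_of_escape_on_both_sides hf hφ hP hs' h1 h2 hev' he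
      · exact false_of_escape_on_both_sides hf hφ hP hs' h1 h2 he hev'
    have key : ∀ {u v : ℝ}, φ u ∈ recurrentPts f → φ v ∈ recurrentPts f →
        (u < v ∧ v < e ∨ e < v ∧ v < u) → ∃ α β, α < u ∧ u < β ∧
          ∀ s ∈ Icc α β, ∃ᶠ n in atTop, f^[n] (φ s) ∈ range φ := by
      intro u v hu hv huv
      rcases huv with ⟨h1, h2⟩ | ⟨h1, h2⟩
      · exact ⟨u - 1, (u + v) / 2, by linarith, by linarith, fun s hs =>
          hside hv (Or.inl ⟨by linarith [hs.2], h2⟩)⟩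
      · exact ⟨(u + v) / 2, u + 1, by linarith, by linarith, fun s hs =>
          hside hv (Or.inr ⟨h1, by linarith [hs.1]⟩)⟩
    have hcases : (t < t₀ ∧ t₀ < e ∨ e < t₀ ∧ t₀ < t) ∨ (t₀ < t ∧ t < e ∨ e < t ∧ t < t₀) := by
      rcases lt_or_gt_of_ne hne with h | h
      · have : d = t₀ - e := by rw [hd, abs_of_neg (by linarith)]; ring
        rcases lt_or_gt_of_ne htne with h' | h'
        · exact Or.inr (Or.inr ⟨by linarith [ht.1], h'⟩)
        · exact Or.inl (Or.inr ⟨h, h'⟩)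
      · have : d = e - t₀ := by rw [hd, abs_of_pos (by linarith)]
        rcases lt_or_gt_of_ne htne with h' | h'
        · exact Or.inl (Or.inl ⟨h', h⟩)
        · exact Or.inr (Or.inl ⟨h', by linarith [ht.2]⟩)
    rcases hcases with h | h
    · obtain ⟨α, β, h1, h2, h3⟩ := key hrect hrec h
      exact ⟨α, β, t, n, h1, h2, hnt.symm, h3⟩
    · obtain ⟨α, β, h1, h2, h3⟩ := key hrec hrect h
      exact ⟨α, β, t₀, 0, h1, h2, rfl, h3⟩
  · exact ⟨t₀ - 1, t₀ + 1, t₀, 0, by linarith, by linarith, rfl, fun s _ hev => hQ ⟨s, hev⟩⟩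

end ArcDynamics

section OrbitClosure

theorem exists_mem_all_of_antitone_of_finite {α : Type*} {F : ℕ → Set α} (hF : Antitone F)
    (hfin : (F 0).Finite) (hne : ∀ n, (F n).Nonempty) : ∃ a, ∀ n, a ∈ F n := by
  by_contra! h
  have h1 : ∀ a ∈ F 0, ∀ᶠ n in atTop, a ∉ F n := fun a _ => by
    obtain ⟨N, hN⟩ := h a
    exact eventually_atTop.2 ⟨N, fun n hn ha => hN (hF hn ha)⟩
  obtain ⟨n, hn⟩ := ((eventually_all_finite hfin).2 h1).exists
  obtain ⟨a, ha⟩ := hne n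
  exact hn a (hF (Nat.zero_le n) ha) ha

theorem subset_periodicPts_of_finite_of_subset_image {α : Type*} {f : α → α} {E : Set α}
    (hE : E.Finite) (h : E ⊆ f '' E) : E ⊆ periodicPts f := by
  have hcard : (f '' E).ncard ≤ E.ncard := ncard_image_le hE
  have heq : E = f '' E := eq_of_subset_of_ncard_le h hcard (hE.image f)
  have hinj : InjOn f E := injOn_of_ncard_image_eq (by rw [← heq]) hE
  have hmaps : MapsTo f E E := fun x hx => heq ▸ mem_image_of_mem f hx
  intro x hx
  have := hE.to_subtype
  have hper := (hmaps.restrict_inj.2 hinj).mem_periodicPts ⟨x, hx⟩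
  have hsemi : Semiconj Subtype.val (hmaps.restrict f E E) f := fun _ => rfl
  exact hsemi.mapsTo_periodicPts hper

theorem mapsTo_setOrbit {α : Type*} {f : α → α} {J : Set α} :
    MapsTo f (setOrbit f J) (setOrbit f J) := by
  intro x hx
  obtain ⟨n, y, hy, rfl⟩ := mem_iUnion.1 hx
  exact mem_iUnion.2 ⟨n + 1, y, hy, iterate_succ_apply' f n y⟩

variable {G : Type*} [TopologicalSpace G] {f : G → G}

theorem IsCompact.exists_bounded_visit_time (hf : Continuous f) {K W : Set G} (hK : IsCompact K)
    (hW : IsOpen W) {N : ℕ} (h : ∀ x ∈ K, ∃ n ≥ N, f^[n] x ∈ W) :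
    ∃ M, ∀ x ∈ K, ∃ n, N ≤ n ∧ n ≤ M ∧ f^[n] x ∈ W := by
  obtain ⟨M, hM⟩ := hK.elim_directed_cover (fun M => ⋃ n ∈ Icc N M, f^[n] ⁻¹' W)
    (fun M => isOpen_biUnion fun n _ => hW.preimage (hf.iterate n))
    (fun x hx => by
      obtain ⟨n, hn, hx⟩ := h x hx
      exact mem_iUnion.2 ⟨n, mem_iUnion₂.2 ⟨n, ⟨hn, le_rfl⟩, hx⟩⟩)
    (Monotone.directed_le fun a b hab =>
      biUnion_subset_biUnion_left (Icc_subset_Icc_right hab))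
  refine ⟨M, fun x hx => ?_⟩
  obtain ⟨n, hn, hx⟩ := mem_iUnion₂.1 (hM hx)
  exact ⟨n, hn.1, hn.2, hx⟩

/-- If the points of a compact set `J` visit `W` infinitely often, the periodic points stay away
from `W`, and the closure of the orbit of `J` adds only finitely many points to the orbit, then
that closure contains no periodic points. -/
theorem disjoint_periodicPts_closure_setOrbit [T2Space G] [CompactSpace G] (hf : Continuous f)
    {W J : Set G} (hW : IsOpen W) (hPW : Disjoint (periodicPts f) (closure W))
    (hJ : IsCompact J) (hfreq : ∀ x ∈ J, ∃ᶠ n in atTop, f^[n] x ∈ W)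
    (hE : (closure (setOrbit f J) \ setOrbit f J).Finite) :
    Disjoint (periodicPts f) (closure (setOrbit f J)) := by
  set Y : ℕ → Set G := fun N => closure (⋃ n, f^[n + N] '' J) with hY
  have hY0 : closure (setOrbit f J) = Y 0 := rfl
  have hYanti : Antitone Y := antitone_nat_of_succ_le fun N => closure_mono <|
    iUnion_subset fun n => subset_iUnion_of_subset (n + 1) (by rw [add_right_comm, add_assoc])
  have hYimage : ∀ N, f '' Y N = Y (N + 1) := fun N => by
    rw [hY]
    dsimp only
    rw [image_closure_of_isCompact isClosed_closure.isCompact hf.continuousOn, image_iUnion]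
    simp_rw [← image_comp, ← iterate_succ']
    rfl
  have hYimages : ∀ k, f^[k] '' Y 0 = Y k := fun k => by
    induction k with
    | zero => simp
    | succ k ih => rw [iterate_succ', image_comp, ih, hYimage]
  have hJY : ∀ {N n x}, x ∈ J → N ≤ n → f^[n] x ∈ Y N := fun {N n x} hx hn =>
    subset_closure (mem_iUnion.2 ⟨n - N, x, hx, by rw [Nat.sub_add_cancel hn]⟩)
  have hPf : MapsTo f (periodicPts f) (periodicPts f) := mapsTo_periodicPts
  rw [disjoint_left]
  intro p hp hpY
  have hpY' : ∀ N, p ∈ Y N := fun N => by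
    obtain ⟨k, hk, hpk⟩ := hp
    have hpk' : f^[N * k] p = p := hpk.const_mul N
    exact hYanti (Nat.le_mul_of_pos_right N hk)
      (hYimages (N * k) ▸ ⟨p, hpY, hpk'⟩)
  set E := closure (setOrbit f J) \ setOrbit f J with hEdef
  set Q : Set G := {w | ∀ᶠ n in atTop, f^[n] w ∉ W} with hQ
  have hclaim : ∀ N, (Y N ∩ closure W ∩ Q).Nonempty := by
    intro N
    by_contra hemp
    have hnQ : ∀ k ∈ Y N ∩ closure W, ∃ᶠ n in atTop, f^[n] k ∈ W := fun k hk hkQ =>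
      hemp ⟨k, hk, hkQ⟩
    have hK : IsCompact (Y N ∩ closure W) :=
      (isClosed_closure.inter isClosed_closure).isCompact
    obtain ⟨M, hM⟩ := hK.exists_bounded_visit_time hf hW (N := 1)
      fun k hk => frequently_atTop.1 (hnQ k hk) 1
    obtain ⟨M', hM'⟩ := hJ.exists_bounded_visit_time hf hW (N := N)
      fun x hx => frequently_atTop.1 (hfreq x hx) N
    have hcl : IsClosed (⋃ d ∈ Iic M, f^[d] '' (Y N ∩ closure W)) :=
      (finite_Iic M).isClosed_biUnion fun d _ => (hK.image (hf.iterate d)).isClosed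
    have hsub : Y M' ⊆ ⋃ d ∈ Iic M, f^[d] '' (Y N ∩ closure W) := by
      refine closure_minimal (iUnion_subset fun n => ?_) hcl
      rintro _ ⟨x, hx, rfl⟩
      obtain ⟨n₀, hn₀, hn₀', hx₀⟩ := hM' x hx
      have hret : ∀ n ≥ n₀, ∃ j, n₀ ≤ j ∧ j ≤ n ∧ n ≤ j + M ∧ f^[j] x ∈ W := by
        intro n hn
        induction n, hn using Nat.le_induction with
        | base => exact ⟨n₀, le_rfl, le_rfl, by omega, hx₀⟩
        | succ n hn ih =>
          obtain ⟨j, h1, h2, h3, h4⟩ := ih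
          by_cases hj : n + 1 ≤ j + M
          · exact ⟨j, h1, by omega, hj, h4⟩
          · obtain ⟨d, hd1, hd2, hd⟩ := hM (f^[j] x) ⟨hJY hx (by omega), subset_closure h4⟩
            rw [← iterate_add_apply] at hd
            exact ⟨d + j, by omega, by omega, by omega, hd⟩
      obtain ⟨j, h1, h2, h3, h4⟩ := hret (n + M') (by omega)
      refine mem_iUnion₂.2 ⟨n + M' - j, by simp only [mem_Iic]; omega, f^[j] x,
        ⟨hJY hx (by omega), subset_closure h4⟩, ?_⟩
      rw [← iterate_add_apply, Nat.sub_add_cancel h2]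
    obtain ⟨d, -, k, hk, hkp⟩ := mem_iUnion₂.1 (hsub (hpY' M'))
    obtain ⟨n, hn, hnW⟩ := frequently_atTop.1 (hnQ k hk) d
    obtain ⟨r, rfl⟩ := Nat.exists_eq_add_of_le' hn
    rw [iterate_add_apply, hkp] at hnW
    exact disjoint_left.1 hPW (hPf.iterate r hp) (subset_closure hnW)
  have hQE : ∀ w ∈ Y 0, w ∈ Q → w ∈ E := by
    intro w hw hwQ
    refine ⟨hw, fun hwO => ?_⟩
    obtain ⟨i, x, hx, rfl⟩ := mem_iUnion.1 hwO
    obtain ⟨N, hN⟩ := eventually_atTop.1 hwQ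
    obtain ⟨n, hn, hnW⟩ := frequently_atTop.1 (hfreq x hx) (N + i)
    refine hN (n - i) (by omega) ?_
    rwa [← iterate_add_apply, Nat.sub_add_cancel (by omega)]
  obtain ⟨v, hv⟩ := exists_mem_all_of_antitone_of_finite (F := fun N => Y N ∩ closure W ∩ Q)
    (fun a b hab => inter_subset_inter_left _ (inter_subset_inter_left _ (hYanti hab)))
    (hE.subset fun w hw => hQE w hw.1.1 hw.2) hclaim
  have hper : E ∩ ⋂ N, Y N ⊆ periodicPts f := by
    refine subset_periodicPts_of_finite_of_subset_image (hE.subset inter_subset_left) ?_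
    rintro e ⟨heE, heY⟩
    have hyE : ∀ N, ∀ y ∈ Y N, f y = e → y ∈ E := fun N y hy hye =>
      ⟨hYanti (Nat.zero_le N) hy, fun hyO => heE.2 (hye ▸ mapsTo_setOrbit hyO)⟩
    obtain ⟨y, hy⟩ := exists_mem_all_of_antitone_of_finite (F := fun N => Y N ∩ f ⁻¹' {e})
      (fun a b hab => inter_subset_inter_left _ (hYanti hab))
      (hE.subset fun y hy => hyE 0 y hy.1 hy.2) (fun N => by
        obtain ⟨y, hy, hye⟩ := (hYimage N).symm ▸ mem_iInter.1 heY (N + 1)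
        exact ⟨y, hy, hye⟩)
    exact ⟨y, ⟨hyE 0 y (hy 0).1 (hy 0).2, mem_iInter.2 fun N => (hy N).1⟩, (hy 0).2⟩
  exact disjoint_left.1 hPW (hper ⟨hQE v (hv 0).1.1 (hv 0).2, mem_iInter.2 fun N => (hv N).1.1⟩)
    (hv 0).1.2

end OrbitClosure

section Charts

theorem exists_isOpenEmbedding_range_eq_Ioo {a b : ℝ} (hab : a < b) :
    ∃ σ : ℝ → ℝ, IsOpenEmbedding σ ∧ range σ = Ioo a b := by
  have hr : (b - a) / 2 ≠ 0 := by linarith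
  set L : ℝ ≃ₜ ℝ := (Homeomorph.mulLeft₀ ((b - a) / 2) hr).trans
    (Homeomorph.addLeft ((a + b) / 2)) with hL
  have hLx : ∀ x, L x = (a + b) / 2 + (b - a) / 2 * x := fun x => rfl
  refine ⟨fun t => L (orderIsoIooNegOneOne ℝ t), L.isOpenEmbedding.comp
    (isOpen_Ioo.isOpenEmbedding_subtypeVal.comp
      (orderIsoIooNegOneOne ℝ).toHomeomorph.isOpenEmbedding), ?_⟩
  ext y
  constructor
  · rintro ⟨t, rfl⟩
    obtain ⟨h1, h2⟩ := (orderIsoIooNegOneOne ℝ t).2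
    simp only [hLx, mem_Ioo]
    constructor <;> nlinarith
  · rintro ⟨h1, h2⟩
    have hz : L.symm y ∈ Ioo (-1 : ℝ) 1 := by
      have h := hLx (L.symm y)
      rw [L.apply_symm_apply] at h
      constructor <;> by_contra! hcon <;> nlinarith
    refine ⟨(orderIsoIooNegOneOne ℝ).symm ⟨L.symm y, hz⟩, ?_⟩
    simp

variable {G : Type*} [TopologicalSpace G]

/-- The closure of a connected set adds only finitely many points in an open arc. -/
theorem finite_preimage_closure_diff [T2Space G] {ψ : ℝ → G} (hψ : IsOpenEmbedding ψ)
    {C : Set G} (hC : IsPreconnected C) : (ψ ⁻¹' (closure C \ C)).Finite := by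
  by_contra hinf
  obtain ⟨s, hs, hcard⟩ := Set.Infinite.exists_subset_card_eq hinf 4
  have hmem : ∀ i, ψ (s.orderEmbOfFin hcard i) ∈ closure C \ C := fun i =>
    hs (s.orderEmbOfFin_mem hcard i)
  have hlt : ∀ {i j : Fin 4}, i < j → s.orderEmbOfFin hcard i < s.orderEmbOfFin hcard j :=
    fun h => (s.orderEmbOfFin hcard).strictMono h
  generalize s.orderEmbOfFin hcard = v at hmem hlt
  have h01 : v 0 < v 1 := hlt (by decide)
  have h12 : v 1 < v 2 := hlt (by decide)
  have h23 : v 2 < v 3 := hlt (by decide)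
  have htrap : ∀ {i j : Fin 4}, (C ∩ ψ '' Ioo (v i) (v j)).Nonempty →
      C ⊆ ψ '' Icc (v i) (v j) := by
    intro i j hne
    refine Subset.trans (hC.subset_of_closure_inter_subset (hψ.isOpenMap _ isOpen_Ioo) hne ?_)
      (image_mono Ioo_subset_Icc_self)
    rintro x ⟨hx, hxC⟩
    obtain ⟨t, ht, rfl⟩ := closure_minimal (image_mono Ioo_subset_Icc_self)
      (isCompact_Icc.image hψ.continuous).isClosed hx
    refine ⟨t, ⟨lt_of_le_of_ne ht.1 ?_, lt_of_le_of_ne ht.2 ?_⟩, rfl⟩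
    · rintro rfl
      exact (hmem i).2 hxC
    · rintro rfl
      exact (hmem j).2 hxC
  have hsub : C ⊆ ψ '' Icc (v 0) (v 2) := by
    obtain ⟨x, ⟨t, ht, rfl⟩, hxC⟩ := mem_closure_iff.1 (hmem 1).1 _
      (hψ.isOpenMap (Ioo (v 0) (v 2)) isOpen_Ioo) ⟨v 1, ⟨h01, h12⟩, rfl⟩
    rcases lt_trichotomy t (v 1) with h | rfl | h
    · exact (htrap ⟨_, hxC, t, ⟨ht.1, h⟩, rfl⟩).trans (image_mono (Icc_subset_Icc_right h12.le))
    · exact absurd hxC (hmem 1).2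
    · exact (htrap ⟨_, hxC, t, ⟨h, ht.2⟩, rfl⟩).trans (image_mono (Icc_subset_Icc_left h01.le))
  obtain ⟨t, ht, hteq⟩ := closure_minimal hsub (isCompact_Icc.image hψ.continuous).isClosed
    (hmem 3).1
  rw [hψ.injective hteq] at ht
  exact absurd ht.2 (not_le.2 h23)

/-- Two arcs with the same endpoints, disjoint otherwise, contain a circle. -/
theorem exists_isCircle_of_two_arcs [T2Space G] {P Q : ℝ → G} (hPc : ContinuousOn P (Icc 0 1))
    (hQc : ContinuousOn Q (Icc 0 1)) (hPi : InjOn P (Icc 0 1)) (hQi : InjOn Q (Icc 0 1))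
    (h0 : P 0 = Q 0) (h1 : P 1 = Q 1)
    (hPQ : ∀ s ∈ Icc (0 : ℝ) 1, ∀ t ∈ Icc (0 : ℝ) 1, P s = Q t → s = t ∧ (s = 0 ∨ s = 1)) :
    ∃ C, IsCircle C ∧ C ⊆ P '' Icc 0 1 ∪ Q '' Icc 0 1 := by
  set S := Metric.sphere (0 : ℂ) 1 with hS
  have hnorm : ∀ z : S, z.1.re ^ 2 + z.1.im ^ 2 = 1 := fun z => by
    have h : ‖z.1‖ = 1 := mem_sphere_zero_iff_norm.1 z.2
    have h2 := Complex.sq_norm z.1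
    rw [h, Complex.normSq_apply] at h2
    nlinarith
  set p : S → ℝ := fun z => (1 + z.1.re) / 2 with hp
  have hpI : ∀ z, p z ∈ Icc (0 : ℝ) 1 := fun z => by
    have := hnorm z
    simp only [hp, mem_Icc]
    constructor <;> nlinarith [sq_nonneg z.1.im]
  have hpc : Continuous p := by
    have : Continuous fun z : S => z.1.re := Complex.continuous_re.comp continuous_subtype_val
    fun_prop
  have him : Continuous fun z : S => z.1.im := Complex.continuous_im.comp continuous_subtype_val
  have hpim : ∀ z, (p z = 0 ∨ p z = 1) ↔ z.1.im = 0 := by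
    intro z
    have h := hnorm z
    have h' : 4 * (p z * (1 - p z)) = z.1.im ^ 2 := by
      simp only [hp]
      linarith
    rw [← pow_eq_zero_iff (a := z.1.im) two_ne_zero, ← h']
    constructor
    · rintro (h | h) <;> rw [h] <;> norm_num
    · intro h
      rcases mul_eq_zero.1 ((mul_eq_zero.1 h).resolve_left (by norm_num)) with h | h
      · exact Or.inl h
      · exact Or.inr (by linarith)
  have hext : ∀ z w : S, p z = p w → 0 ≤ z.1.im * w.1.im → z = w := by
    intro z w hzw hsgn
    have hre : z.1.re = w.1.re := by
      simp only [hp] at hzw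
      linarith
    have h1 := hnorm z
    have h2 := hnorm w
    rw [hre] at h1
    refine Subtype.ext (Complex.ext hre ?_)
    rcases sq_eq_sq_iff_eq_or_eq_neg.1 (by linarith : z.1.im ^ 2 = w.1.im ^ 2) with h | h
    · exact h
    · rw [h] at hsgn
      have : w.1.im = 0 := by nlinarith
      rw [h, this, neg_zero]
  set F : S → G := fun z => if 0 ≤ z.1.im then P (p z) else Q (p z) with hF
  have hFc : Continuous F := by
    refine Continuous.if_le (hPc.comp_continuous hpc hpI) (hQc.comp_continuous hpc hpI)
      continuous_const him fun z hz => ?_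
    rcases (hpim z).2 hz.symm with h | h <;> rw [h]
    · exact h0
    · exact h1
  have hcross : ∀ z w : S, 0 ≤ z.1.im → w.1.im < 0 → P (p z) ≠ Q (p w) := by
    intro z w _ hw h
    obtain ⟨h1, h2⟩ := hPQ _ (hpI z) _ (hpI w) h
    exact hw.ne ((hpim w).1 (h1 ▸ h2))
  have hFi : Injective F := by
    intro z w h
    simp only [hF] at h
    split_ifs at h with hz hw hw
    · exact hext z w (hPi (hpI z) (hpI w) h) (mul_nonneg hz hw)
    · exact absurd h (hcross z w hz (not_le.1 hw))
    · exact absurd h.symm (hcross w z hw (not_le.1 hz))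
    · exact hext z w (hQi (hpI z) (hpI w) h)
        (mul_nonneg_of_nonpos_of_nonpos (not_le.1 hz).le (not_le.1 hw).le)
  refine ⟨range F, ⟨(hFc.isClosedEmbedding hFi).isEmbedding.toHomeomorph.symm⟩, ?_⟩
  rintro _ ⟨z, rfl⟩
  simp only [hF]
  split_ifs
  · exact Or.inl ⟨p z, hpI z, rfl⟩
  · exact Or.inr ⟨p z, hpI z, rfl⟩

end Charts

section Edges

theorem closure_connectedComponentIn_subset {X : Type*} [TopologicalSpace X] (V : Set X) (x : X) :
    closure (connectedComponentIn Vᶜ x) ⊆ connectedComponentIn Vᶜ x ∪ V := by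
  intro y hy
  by_cases hyV : y ∈ V
  · exact Or.inr hyV
  refine Or.inl ?_
  by_cases hx : x ∈ Vᶜ
  · have hpre : IsPreconnected (insert y (connectedComponentIn Vᶜ x)) :=
      isPreconnected_connectedComponentIn.subset_closure (subset_insert _ _)
        (insert_subset hy subset_closure)
    exact hpre.subset_connectedComponentIn (mem_insert_of_mem _ (mem_connectedComponentIn hx))
      (insert_subset hyV (connectedComponentIn_subset _ _)) (mem_insert _ _)
  · simp [connectedComponentIn_eq_empty hx] at hy

variable {G : Type*} [MetricSpace G] {V : Set G}

/-- An open arc whose closure only adds points of a finite set has a limit at its left end. -/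
theorem exists_tendsto_nhdsGT_of_arc [CompactSpace G] (hV : V.Finite) {A : Set G}
    (hcl : closure A ⊆ A ∪ V) {h : ℝ → G} {g : G → ℝ}
    (hc : ContinuousOn h (Ioo 0 1)) (hA : MapsTo h (Ioo 0 1) A) (hgc : ContinuousOn g A)
    (hgA : MapsTo g A (Ioo 0 1)) (hgh : ∀ t ∈ Ioo (0 : ℝ) 1, g (h t) = t) :
    ∃ v ∈ V, Tendsto h (𝓝[>] 0) (𝓝 v) := by
  have hev : ∀ ε > (0 : ℝ), ∀ᶠ t in 𝓝[>] (0 : ℝ), t ∈ Ioo 0 ε := fun ε hε =>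
    Ioo_mem_nhdsGT hε
  have hclV : ∀ c, MapClusterPt c (𝓝[>] 0) h → c ∈ V := by
    intro c hcl'
    have hcA : c ∈ closure A := mem_closure_iff_nhds.2 fun U hU => by
      obtain ⟨t, htU, ht⟩ := ((mapClusterPt_iff_frequently.1 hcl' U hU).and_eventually
        (hev 1 one_pos)).exists
      exact ⟨h t, htU, hA ht⟩
    refine (hcl hcA).resolve_left fun hcA' => ?_
    have hg0 := (hgA hcA').1
    have hU := (hgc c hcA').eventually (lt_mem_nhds (half_lt_self hg0))
    obtain ⟨U, hU, hUA⟩ := mem_nhdsWithin_iff_exists_mem_nhds_inter.1 hU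
    obtain ⟨t, htU, ht1, ht2⟩ := ((mapClusterPt_iff_frequently.1 hcl' U hU).and_eventually
      ((hev 1 one_pos).and (hev _ (half_pos hg0)))).exists
    have h1 : g c / 2 < g (h t) := hUA ⟨htU, hA ht1⟩
    rw [hgh t ht1] at h1
    exact lt_asymm h1 ht2.2
  obtain ⟨v, hv⟩ := exists_clusterPt_of_compactSpace (map h (𝓝[>] 0))
  have hv : MapClusterPt v (𝓝[>] 0) h := hv
  have hvV := hclV v hv
  refine ⟨v, hvV, ?_⟩
  obtain ⟨r₀, hr₀, hr₀V⟩ : ∃ r₀ > 0, ∀ w ∈ V, w ≠ v → r₀ ≤ dist w v := by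
    have hmem : (V \ {v})ᶜ ∈ 𝓝 v :=
      ((hV.subset sdiff_subset).isClosed).isOpen_compl.mem_nhds (by simp)
    obtain ⟨r₀, hr₀, hsub⟩ := Metric.mem_nhds_iff.1 hmem
    refine ⟨r₀, hr₀, fun w hw hwv => ?_⟩
    by_contra! hlt
    exact hsub (mem_ball.2 hlt) ⟨hw, hwv⟩
  rw [Metric.tendsto_nhds]
  intro ε hε
  set r := min ε (r₀ / 2) with hr
  have hr0 : 0 < r := lt_min hε (half_pos hr₀)
  have hrlt : r < r₀ := (min_le_right _ _).trans_lt (half_lt_self hr₀)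
  have hsphere : ∀ᶠ t in 𝓝[>] (0 : ℝ), h t ∉ sphere v r := by
    by_contra hcon
    have hcomp : IsCompact (sphere v r) := isClosed_sphere.isCompact
    obtain ⟨c, hcS, hcc⟩ := hcomp.exists_mapClusterPt_of_frequently
      (show ∃ᶠ t in 𝓝[>] (0 : ℝ), h t ∈ sphere v r from fun hcon' => hcon hcon')
    rw [mem_sphere] at hcS
    have := hr₀V c (hclV c hcc) (by rintro rfl; rw [dist_self] at hcS; linarith)
    linarith
  obtain ⟨δ, hδ, hδsub⟩ := mem_nhdsGT_iff_exists_Ioo_subset.1 (hsphere.and (hev 1 one_pos))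
  have hδ : 0 < δ := hδ
  obtain ⟨s, hsball, hsδ⟩ := ((mapClusterPt_iff_frequently.1 hv _
    (ball_mem_nhds v hr0)).and_eventually (hev δ hδ)).exists
  filter_upwards [hev δ hδ] with t ht
  refine lt_of_lt_of_le ?_ (min_le_left ε (r₀ / 2))
  by_contra! hge
  have hcont : ContinuousOn (fun t => dist (h t) v) (Ioo 0 δ) :=
    (continuous_id.dist continuous_const).comp_continuousOn (hc.mono fun u hu => (hδsub hu).2)
  obtain ⟨u, hu, hur⟩ := isPreconnected_Ioo.intermediate_value hsδ ht hcont
    ⟨(mem_ball.1 hsball).le, hge⟩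
  exact (hδsub hu).1 hur

theorem exists_inverse_param {X : Type*} [TopologicalSpace X] {A : Set X}
    (e : A ≃ₜ Ioo (0 : ℝ) 1) : ∃ (h : ℝ → X) (g : X → ℝ), ContinuousOn h (Ioo 0 1) ∧
      MapsTo h (Ioo 0 1) A ∧ ContinuousOn g A ∧ MapsTo g A (Ioo 0 1) ∧
      (∀ t ∈ Ioo (0 : ℝ) 1, g (h t) = t) ∧ ∀ y ∈ A, h (g y) = y := by
  set h : ℝ → X := Function.extend Subtype.val (fun t => (e.symm t).1)
    fun _ => (e.symm ⟨1 / 2, by norm_num, by norm_num⟩).1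
  set g : X → ℝ := Function.extend Subtype.val (fun y => (e y).1) fun _ => 0
  have hh : ∀ t : Ioo (0 : ℝ) 1, h t = e.symm t := Subtype.val_injective.extend_apply _ _
  have hg : ∀ y : A, g y = e y := Subtype.val_injective.extend_apply _ _
  refine ⟨h, g, ?_, fun t ht => ?_, ?_, fun y hy => ?_, fun t ht => ?_, fun y hy => ?_⟩
  · rw [continuousOn_iff_continuous_domRestrict]
    exact (continuous_subtype_val.comp e.symm.continuous).congr fun t => (hh t).symm
  · rw [hh ⟨t, ht⟩]
    exact (e.symm _).2
  · rw [continuousOn_iff_continuous_domRestrict]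
    exact (continuous_subtype_val.comp e.continuous).congr fun y => (hg y).symm
  · rw [hg ⟨y, hy⟩]
    exact (e _).2
  · rw [hh ⟨t, ht⟩, hg, e.apply_symm_apply]
  · rw [hg ⟨y, hy⟩, hh, e.symm_apply_apply]

/-- An edge of a graph is the image of an open interval, with endpoints going to vertices. -/
theorem IsTopGraph.exists_edge_param (hG : IsTopGraph V) {x : G} (hx : x ∉ V) :
    ∃ H : ℝ → G, ContinuousOn H (Icc 0 1) ∧ InjOn H (Ioo 0 1) ∧
      H '' Ioo 0 1 = connectedComponentIn Vᶜ x ∧ H 0 ∈ V ∧ H 1 ∈ V := by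
  have := hG.compact
  obtain ⟨e⟩ := hG.component_openArc x hx
  have hcl := closure_connectedComponentIn_subset V x
  obtain ⟨h, g, hc, hhA, hgc, hgA, hgh, hhg⟩ := exists_inverse_param e
  have hrefl : MapsTo (fun t : ℝ => 1 - t) (Ioo 0 1) (Ioo 0 1) := fun t ht =>
    ⟨by linarith [ht.2], by linarith [ht.1]⟩
  obtain ⟨v, hv, hvt⟩ := exists_tendsto_nhdsGT_of_arc hG.finite_vertexSet hcl hc hhA hgc hgA hgh
  obtain ⟨w, hw, hwt⟩ := exists_tendsto_nhdsGT_of_arc hG.finite_vertexSet hcl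
    (h := fun t => h (1 - t)) (g := fun y => 1 - g y)
    (hc.comp (by fun_prop) hrefl) (hhA.comp hrefl) (continuousOn_const.sub hgc)
    (hrefl.comp hgA) (fun t ht => by rw [hgh _ (hrefl ht), sub_sub_cancel])
  have hwt' : Tendsto h (𝓝[<] 1) (𝓝 w) := by
    have hlim : Tendsto (fun t : ℝ => 1 - t) (𝓝[<] 1) (𝓝[>] 0) := by
      refine tendsto_nhdsWithin_iff.2 ⟨?_, ?_⟩
      · have : Tendsto (fun t : ℝ => 1 - t) (𝓝 1) (𝓝 (1 - 1)) :=
          (continuous_const.sub continuous_id).tendsto 1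
        rw [sub_self] at this
        exact this.mono_left nhdsWithin_le_nhds
      · filter_upwards [self_mem_nhdsWithin] with t ht
        exact sub_pos.2 (mem_Iio.1 ht)
    simpa [comp_def] using hwt.comp hlim
  have hext : ∀ t ∈ Ioo (0 : ℝ) 1, extendFrom (Ioo 0 1) h t = h t := fun t ht =>
    extendFrom_eq (subset_closure ht) (hc t ht)
  refine ⟨extendFrom (Ioo 0 1) h, continuousOn_Icc_extendFrom_Ioo hc hvt hwt', ?_, ?_, ?_, ?_⟩
  · intro s hs t ht hst
    rw [hext s hs, hext t ht] at hst
    rw [← hgh s hs, ← hgh t ht, hst]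
  · rw [image_congr hext]
    exact Subset.antisymm hhA.image_subset fun y hy => ⟨g y, hgA hy, hhg y hy⟩
  · rwa [eq_lim_at_left_extendFrom_Ioo zero_lt_one hvt]
  · rwa [eq_lim_at_right_extendFrom_Ioo zero_lt_one hwt']

theorem injOn_Icc_of_injOn_Ioo {α : Type*} {A V : Set α} (hAV : Disjoint A V) {H : ℝ → α}
    (hi : InjOn H (Ioo 0 1)) (hA : H '' Ioo 0 1 = A) (h0 : H 0 ∈ V) (h1 : H 1 ∈ V)
    (hne : H 0 ≠ H 1) : InjOn H (Icc 0 1) := by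
  have hmem : ∀ t ∈ Ioo (0 : ℝ) 1, H t ∉ V := fun t ht =>
    disjoint_left.1 hAV (hA ▸ mem_image_of_mem H ht)
  intro s hs t ht hst
  rcases eq_endpoints_or_mem_Ioo_of_mem_Icc hs with rfl | rfl | hs <;>
  rcases eq_endpoints_or_mem_Ioo_of_mem_Icc ht with rfl | rfl | ht
  · rfl
  · exact absurd hst hne
  · exact absurd (hst ▸ h0) (hmem t ht)
  · exact absurd hst.symm hne
  · rfl
  · exact absurd (hst ▸ h1) (hmem t ht)
  · exact absurd (hst.symm ▸ h0) (hmem s hs)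
  · exact absurd (hst.symm ▸ h1) (hmem s hs)
  · exact hi hs ht hst

theorem IsTopGraph.not_isCircle_of_inter_subset (hG : IsTopGraph V) {C : Set G} {u w : G}
    (hC : C ∩ V ⊆ {u, w}) : ¬ IsCircle C := fun h => by
  have h1 := hG.circle_vertices C h
  have h2 := ncard_le_ncard hC
  have h3 : ({u, w} : Set G).ncard ≤ 2 := (ncard_insert_le u {w}).trans (by simp)
  omega

/-- No edge of a graph is a loop. -/
theorem IsTopGraph.endpoints_ne (hG : IsTopGraph V) {A : Set G} (hAV : Disjoint A V) {H : ℝ → G}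
    (hc : ContinuousOn H (Icc 0 1)) (hi : InjOn H (Ioo 0 1)) (hA : H '' Ioo 0 1 = A)
    (h0 : H 0 ∈ V) (h1 : H 1 ∈ V) : H 0 ≠ H 1 := by
  intro heq
  have hmem : ∀ t ∈ Ioo (0 : ℝ) 1, H t ∉ V := fun t ht =>
    disjoint_left.1 hAV (hA ▸ mem_image_of_mem H ht)
  have hends : ∀ t ∈ Icc (0 : ℝ) 1, H t ∈ V → t = 0 ∨ t = 1 := by
    intro t ht htV
    rcases eq_endpoints_or_mem_Ioo_of_mem_Icc ht with h | h | h
    · exact Or.inl h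
    · exact Or.inr h
    · exact absurd htV (hmem t h)
  have hl : MapsTo (fun t : ℝ => t / 2) (Icc 0 1) (Icc 0 1) := fun t ht =>
    ⟨by linarith [ht.1], by linarith [ht.2]⟩
  have hr : MapsTo (fun t : ℝ => 1 - t / 2) (Icc 0 1) (Icc 0 1) := fun t ht =>
    ⟨by linarith [ht.2], by linarith [ht.1]⟩
  have hinj : ∀ s ∈ Icc (0 : ℝ) 1, ∀ t ∈ Icc (0 : ℝ) 1, H s = H t →
      s = t ∨ s = 0 ∧ t = 1 ∨ s = 1 ∧ t = 0 := by
    intro s hs t ht hst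
    by_cases hsV : H s ∈ V
    · rcases hends s hs hsV with rfl | rfl <;> rcases hends t ht (hst ▸ hsV) with rfl | rfl <;>
        simp
    · rcases eq_endpoints_or_mem_Ioo_of_mem_Icc hs with rfl | rfl | hs'
      · exact absurd h0 hsV
      · exact absurd h1 hsV
      rcases eq_endpoints_or_mem_Ioo_of_mem_Icc ht with rfl | rfl | ht'
      · exact absurd (hst ▸ h0) hsV
      · exact absurd (hst ▸ h1) hsV
      exact Or.inl (hi hs' ht' hst)
  obtain ⟨C, hC, hCsub⟩ := exists_isCircle_of_two_arcs (P := fun t => H (t / 2))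
    (Q := fun t => H (1 - t / 2)) (hc.comp (by fun_prop) hl) (hc.comp (by fun_prop) hr)
    (fun s hs t ht hst => by
      rcases hinj _ (hl hs) _ (hl ht) hst with h | h | h <;> linarith [hs.1, hs.2, ht.1, ht.2])
    (fun s hs t ht hst => by
      rcases hinj _ (hr hs) _ (hr ht) hst with h | h | h <;> linarith [hs.1, hs.2, ht.1, ht.2])
    (by simpa using heq) (by norm_num)
    (fun s hs t ht hst => by
      rcases hinj _ (hl hs) _ (hr ht) hst with h | h | h
      · have hs1 : s = 1 := by linarith [hs.2, ht.2]
        exact ⟨by linarith, Or.inr hs1⟩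
      · have hs0 : s = 0 := by linarith
        exact ⟨by linarith, Or.inl hs0⟩
      · linarith [hs.2])
  refine hG.not_isCircle_of_inter_subset (u := H 0) (w := H 1) ?_ hC
  rintro y ⟨hyC, hyV⟩
  obtain ⟨t, ht, rfl⟩ : ∃ t ∈ Icc (0 : ℝ) 1, H t = y := by
    rcases hCsub hyC with ⟨t, ht, rfl⟩ | ⟨t, ht, rfl⟩
    exacts [⟨_, hl ht, rfl⟩, ⟨_, hr ht, rfl⟩]
  rcases hends t ht hyV with rfl | rfl <;> simp

/-- A graph has finitely many edges. -/
theorem IsTopGraph.finite_edges (hG : IsTopGraph V) :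
    {A : Set G | ∃ x ∉ V, connectedComponentIn Vᶜ x = A}.Finite := by
  set 𝒜 := {A : Set G | ∃ x ∉ V, connectedComponentIn Vᶜ x = A} with h𝒜
  have hdisjV : ∀ A ∈ 𝒜, Disjoint A V := by
    rintro _ ⟨x, hx, rfl⟩
    exact disjoint_left.2 fun y hy => connectedComponentIn_subset _ _ hy
  have hparam : ∀ A ∈ 𝒜, ∃ H : ℝ → G, ContinuousOn H (Icc 0 1) ∧ InjOn H (Ioo 0 1) ∧
      H '' Ioo 0 1 = A ∧ H 0 ∈ V ∧ H 1 ∈ V := by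
    rintro _ ⟨x, hx, rfl⟩
    exact hG.exists_edge_param hx
  have : Nonempty G := hG.connected.toNonempty
  choose! H hHc hHi hHA hH0 hH1 using hparam
  by_contra hinf
  obtain ⟨A, hA, B, hB, hAB, heq⟩ := Set.Infinite.exists_ne_map_eq_of_mapsTo hinf
    (f := fun A => (H A 0, H A 1)) (t := V ×ˢ V) (fun A hA => ⟨hH0 A hA, hH1 A hA⟩)
    (hG.finite_vertexSet.prod hG.finite_vertexSet)
  obtain ⟨heq0, heq1⟩ := Prod.mk.inj heq
  have hdisj : Disjoint A B := by
    rw [disjoint_left]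
    intro y hyA hyB
    obtain ⟨a, -, rfl⟩ := hA
    obtain ⟨b, -, rfl⟩ := hB
    exact hAB ((connectedComponentIn_eq hyA).trans (connectedComponentIn_eq hyB).symm)
  have hnV : ∀ {A}, A ∈ 𝒜 → ∀ t ∈ Ioo (0 : ℝ) 1, H A t ∈ A ∧ H A t ∉ V := fun {A} hA t ht => by
    have : H A t ∈ A := by
      have h := mem_image_of_mem (H A) ht
      rwa [hHA A hA] at h
    exact ⟨this, disjoint_left.1 (hdisjV A hA) this⟩
  have hends : ∀ {A}, A ∈ 𝒜 → ∀ t ∈ Icc (0 : ℝ) 1, H A t ∈ V → t = 0 ∨ t = 1 := by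
    intro A hA t ht htV
    rcases eq_endpoints_or_mem_Ioo_of_mem_Icc ht with h | h | h
    · exact Or.inl h
    · exact Or.inr h
    · exact absurd htV (hnV hA t h).2
  have hneA := hG.endpoints_ne (hdisjV A hA) (hHc A hA) (hHi A hA) (hHA A hA) (hH0 A hA) (hH1 A hA)
  have hneB := hG.endpoints_ne (hdisjV B hB) (hHc B hB) (hHi B hB) (hHA B hB) (hH0 B hB) (hH1 B hB)
  obtain ⟨C, hC, hCsub⟩ := exists_isCircle_of_two_arcs (hHc A hA) (hHc B hB)
    (injOn_Icc_of_injOn_Ioo (hdisjV A hA) (hHi A hA) (hHA A hA) (hH0 A hA) (hH1 A hA) hneA)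
    (injOn_Icc_of_injOn_Ioo (hdisjV B hB) (hHi B hB) (hHA B hB) (hH0 B hB) (hH1 B hB) hneB)
    heq0 heq1 (fun s hs t ht hst => by
      rcases eq_endpoints_or_mem_Ioo_of_mem_Icc hs with rfl | rfl | hs'
      · rcases hends hB t ht (hst ▸ hH0 A hA) with rfl | rfl
        · simp
        · exact absurd (heq0 ▸ hst) hneB
      · rcases hends hB t ht (hst ▸ hH1 A hA) with rfl | rfl
        · exact absurd (heq1 ▸ hst).symm hneB
        · simp
      · obtain ⟨h1, h2⟩ := hnV hA s hs'
        rcases eq_endpoints_or_mem_Ioo_of_mem_Icc ht with rfl | rfl | ht'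
        · exact absurd (hst ▸ hH0 B hB) h2
        · exact absurd (hst ▸ hH1 B hB) h2
        · exact absurd (hst ▸ (hnV hB t ht').1) (disjoint_left.1 hdisj h1))
  refine hG.not_isCircle_of_inter_subset (u := H A 0) (w := H A 1) ?_ hC
  rintro y ⟨hyC, hyV⟩
  rcases hCsub hyC with ⟨t, ht, rfl⟩ | ⟨t, ht, rfl⟩
  · rcases hends hA t ht hyV with rfl | rfl <;> simp
  · rcases hends hB t ht hyV with rfl | rfl <;> simp [heq0, heq1]

/-- Every edge of a graph is the range of an open embedding of the line. -/
theorem IsTopGraph.exists_chart (hG : IsTopGraph V) {x : G} (hx : x ∉ V) :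
    ∃ ψ : ℝ → G, IsOpenEmbedding ψ ∧ range ψ = connectedComponentIn Vᶜ x := by
  set A := connectedComponentIn Vᶜ x with hA
  have hopen : IsOpen A := by
    have hfin : ({B : Set G | ∃ y ∉ V, connectedComponentIn Vᶜ y = B} \ {A}).Finite :=
      hG.finite_edges.subset sdiff_subset
    have hAeq : A = (V ∪ ⋃ B ∈ {B : Set G | ∃ y ∉ V, connectedComponentIn Vᶜ y = B} \ {A},
        closure B)ᶜ := by
      ext y
      simp only [mem_compl_iff, mem_union, not_or, mem_iUnion, not_exists]
      constructor
      · intro hy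
        have hyV : y ∉ V := connectedComponentIn_subset _ _ hy
        refine ⟨hyV, ?_⟩
        rintro _ ⟨⟨z, hz, rfl⟩, hne⟩ hyB
        have hyB' := (closure_connectedComponentIn_subset V z hyB).resolve_right hyV
        exact hne ((connectedComponentIn_eq hyB').trans (connectedComponentIn_eq hy).symm)
      · rintro ⟨hyV, h⟩
        have hyy : y ∈ connectedComponentIn Vᶜ y := mem_connectedComponentIn hyV
        by_contra hyA
        exact h _ ⟨⟨y, hyV, rfl⟩, fun heq => hyA (heq ▸ hyy)⟩ (subset_closure hyy)
    rw [hAeq]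
    exact (hG.finite_vertexSet.isClosed.union
      (hfin.isClosed_biUnion fun _ _ => isClosed_closure)).isOpen_compl
  obtain ⟨e⟩ := hG.component_openArc x hx
  obtain ⟨σ, hσ, hσr⟩ := exists_isOpenEmbedding_range_eq_Ioo (zero_lt_one' ℝ)
  set E : ℝ ≃ₜ A := (hσ.isEmbedding.toHomeomorph.trans (Homeomorph.setCongr hσr)).trans e.symm
  refine ⟨fun t => (E t).1, hopen.isOpenEmbedding_subtypeVal.comp E.isOpenEmbedding, ?_⟩
  rw [← Function.comp_def, range_comp, E.surjective.range_eq, image_univ, Subtype.range_coe]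

/-- In a graph, the closure of a connected set adds only finitely many points. -/
theorem IsTopGraph.finite_closure_diff (hG : IsTopGraph V) {C : Set G} (hC : IsPreconnected C) :
    (closure C \ C).Finite := by
  refine (hG.finite_vertexSet.union (hG.finite_edges.biUnion
    (t := fun A => (closure C \ C) ∩ A) ?_)).subset fun y hy => ?_
  · rintro _ ⟨x, hx, rfl⟩
    obtain ⟨ψ, hψ, hr⟩ := hG.exists_chart hx
    rw [← hr, ← image_preimage_eq_inter_range]
    exact (finite_preimage_closure_diff hψ hC).image ψ
  · by_cases hyV : y ∈ V
    · exact Or.inl hyV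
    · exact Or.inr (mem_iUnion₂.2 ⟨_, ⟨y, hyV, rfl⟩, hy, mem_connectedComponentIn hyV⟩)

end Edges

section ReturningSet

/-- The orbit of a connected set which meets its image under `f^[m]` is covered by an
`m`-periodic sequence of connected sets, each mapped into the next one. -/
theorem exists_periodic_cover_setOrbit {G : Type*} [TopologicalSpace G] {f : G → G}
    (hf : Continuous f) {J : Set G} (hJ : IsPreconnected J) {m : ℕ}
    (hret : (f^[m] '' J ∩ J).Nonempty) :
    ∃ T : ℕ → Set G, (∀ n, T (n + m) = T n) ∧ (∀ n, IsPreconnected (T n)) ∧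
      (∀ n, (T n).Nonempty) ∧ ⋃ n, T n = setOrbit f J ∧ ∀ n, MapsTo f (T n) (T (n + 1)) := by
  obtain ⟨_, ⟨y, hy, rfl⟩, hyJ⟩ := hret
  refine ⟨fun n => ⋃ q : ℕ, f^[n % m + q * m] '' J, fun n => by simp, fun n => ?_,
    fun n => ⟨_, mem_iUnion.2 ⟨0, y, hy, rfl⟩⟩, ?_, fun n => ?_⟩
  · refine IsPreconnected.iUnion_of_chain (fun q => hJ.image _ (hf.iterate _).continuousOn)
      fun q => ⟨f^[n % m + q * m] (f^[m] y), ⟨_, hyJ, rfl⟩, y, hy, ?_⟩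
    rw [← iterate_add_apply, Nat.succ_eq_succ, Nat.succ_mul, add_assoc]
  · refine Subset.antisymm (iUnion_subset fun n => iUnion_subset fun q =>
      subset_iUnion (fun i => f^[i] '' J) _) (iUnion_subset fun n => ?_)
    refine subset_iUnion_of_subset n (subset_iUnion_of_subset (n / m) ?_)
    rw [Nat.mod_add_div']
  · intro w hw
    obtain ⟨q, z, hz, rfl⟩ := mem_iUnion.1 hw
    refine mem_iUnion.2 ⟨q + (n % m + 1) / m, z, hz, ?_⟩
    rw [← iterate_succ_apply' f]
    congr 1
    have h1 := Nat.mod_add_div' (n % m + 1) m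
    rw [Nat.mod_add_mod] at h1
    rw [Nat.add_mul]
    omega

theorem closure_iUnion_of_periodic {X : Type*} [TopologicalSpace X] {T : ℕ → Set X} {m : ℕ}
    (hm : 0 < m) (hT : ∀ n, T (n + m) = T n) : closure (⋃ n, T n) = ⋃ n, closure (T n) := by
  have hmod : ∀ n, T (n % m) = T n := fun n => Function.Periodic.map_mod_nat hT n
  refine Subset.antisymm ?_ (iUnion_subset fun n => closure_mono (subset_iUnion T n))
  have : ⋃ n, T n = ⋃ n ∈ Iio m, T n := Subset.antisymm
    (iUnion_subset fun n => hmod n ▸ subset_biUnion_of_mem (u := T) (mem_Iio.2 (Nat.mod_lt n hm)))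
    (iUnion₂_subset fun n _ => subset_iUnion T n)
  rw [this, (finite_Iio m).closure_biUnion]
  exact iUnion₂_subset fun n _ => subset_iUnion (fun n => closure (T n)) n

theorem exists_iterate_mem_periodicPts_of_finite {α : Type*} {f : α → α} {x : α} {S : Set α}
    (hS : S.Finite) (h : ∀ n, f^[n] x ∈ S) : ∃ n, f^[n] x ∈ periodicPts f := by
  obtain ⟨a, -, b, -, hab, heq⟩ := Set.Infinite.exists_ne_map_eq_of_mapsTo infinite_univ
    (f := fun n => f^[n] x) (fun n _ => h n) hS
  wlog hlt : a < b generalizing a b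
  · exact this b a hab.symm heq.symm (by omega)
  refine ⟨a, b - a, by omega, ?_⟩
  rw [IsPeriodicPt, Function.IsFixedPt, ← iterate_add_apply, Nat.sub_add_cancel hlt.le]
  exact heq.symm

variable {G : Type*} [MetricSpace G] {V : Set G} {f : G → G} {J W : Set G}

/-- In a graph, the orbit closure of a compact connected set which meets one of its images and
whose points visit an open set away from the periodic points infinitely often is
component-cyclic and has no eventually periodic points. -/
theorem IsTopGraph.componentCyclic_closure_setOrbit (hG : IsTopGraph V) (hf : Continuous f)
    (hW : IsOpen W) (hPW : Disjoint (periodicPts f) (closure W)) (hJ : IsCompact J)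
    (hJc : IsPreconnected J) (hfreq : ∀ x ∈ J, ∃ᶠ n in atTop, f^[n] x ∈ W) {m : ℕ} (hm : 0 < m)
    (hret : (f^[m] '' J ∩ J).Nonempty) :
    ComponentCyclic f (closure (setOrbit f J)) ∧ closure (setOrbit f J) ⊆ (evPeriodicPts f)ᶜ := by
  have := hG.compact
  obtain ⟨T, hper, hpre, hne, hT, hmap⟩ := exists_periodic_cover_setOrbit hf hJc hret
  have hcl := closure_iUnion_of_periodic hm hper
  refine ⟨componentCyclic_of_periodic_cover hf hm (S := fun n => closure (T n))
    (fun n => by rw [hper]) (fun n => (hpre n).closure) (fun n => (hne n).closure)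
    (by rw [← hcl, hT]) fun n => (hmap n).closure hf, ?_⟩
  have hE : (closure (setOrbit f J) \ setOrbit f J).Finite := by
    refine ((finite_Iio m).biUnion fun n _ => hG.finite_closure_diff (hpre n)).subset ?_
    rintro y ⟨hy, hyO⟩
    rw [← hT, hcl] at hy
    obtain ⟨n, hn⟩ := mem_iUnion.1 hy
    have hmod : T (n % m) = T n := Function.Periodic.map_mod_nat hper n
    refine mem_iUnion₂.2 ⟨n % m, Nat.mod_lt n hm, hmod.symm ▸ hn, fun hyT => hyO ?_⟩
    exact hT ▸ mem_iUnion_of_mem _ hyT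
  have hdisj := disjoint_periodicPts_closure_setOrbit hf hW hPW hJ hfreq hE
  intro w hw hwfin
  obtain ⟨n, hn⟩ := exists_iterate_mem_periodicPts_of_finite (f := f) (x := w) hwfin
    fun n => mem_range_self n
  exact disjoint_left.1 hdisj hn ((mapsTo_setOrbit.closure hf).iterate n hw)

end ReturningSet

/-- for every `x ∈ R(f) − cl(P(f))` there is a component-cyclic
`f`-invariant closed set `Y` with `x ∈ Y ⊆ G − EP(f)`. -/
theorem componentCyclic_exists {G : Type*} [MetricSpace G] (V : Set G)
    (hG : IsTopGraph V) (f : G → G) (hf : Continuous f) :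
    ∀ x ∈ recurrentPts f \ closure (Function.periodicPts f),
      ∃ Y : Set G, ComponentCyclic f Y ∧ IsClosed Y ∧ x ∈ Y ∧
        Y ⊆ (evPeriodicPts f)ᶜ := by
  rintro x ⟨hx, hxP⟩
  have hPorbit : ∀ l, f^[l] x ∉ closure (periodicPts f) := fun l hl => by
    refine hxP (closure_minimal ?_ isClosed_closure (mem_closure_orbit_of_recurrent hx l))
    rintro _ ⟨n, rfl⟩
    exact (mapsTo_periodicPts.closure hf).iterate n hl
  obtain ⟨l, hl⟩ : ∃ l, f^[l] x ∉ V := by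
    by_contra! h
    obtain ⟨n, hn⟩ := exists_iterate_mem_periodicPts_of_finite hG.finite_vertexSet h
    exact hPorbit n (subset_closure hn)
  obtain ⟨ψ, hψ, hψr⟩ := hG.exists_chart hl
  obtain ⟨t₀, ht₀⟩ : f^[l] x ∈ range ψ := hψr ▸ mem_connectedComponentIn hl
  have hnhds : ψ ⁻¹' (closure (periodicPts f))ᶜ ∈ 𝓝 t₀ :=
    hψ.continuous.continuousAt (isClosed_closure.isOpen_compl.mem_nhds (ht₀ ▸ hPorbit l))
  obtain ⟨δ, hδ, hδsub⟩ := Metric.nhds_basis_closedBall.mem_iff.1 hnhds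
  rw [Real.closedBall_eq_Icc] at hδsub
  obtain ⟨σ, hσ, hσr⟩ := exists_isOpenEmbedding_range_eq_Ioo (by linarith : t₀ - δ < t₀ + δ)
  have hφ : IsOpenEmbedding (ψ ∘ σ) := hψ.comp hσ
  have hPW : Disjoint (periodicPts f) (closure (range (ψ ∘ σ))) := by
    refine disjoint_left.2 fun p hp hpW => ?_
    rw [range_comp, hσr] at hpW
    obtain ⟨t, ht, rfl⟩ := closure_minimal (image_mono Ioo_subset_Icc_self)
      (isCompact_Icc.image hψ.continuous).isClosed hpW
    exact hδsub ht (subset_closure hp)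
  obtain ⟨s₀, hs₀⟩ : t₀ ∈ range σ := hσr ▸ ⟨by linarith, by linarith⟩
  have hs₀x : (ψ ∘ σ) s₀ = f^[l] x := by rw [comp_apply, hs₀, ht₀]
  obtain ⟨α, β, t, l', hαt, htβ, hl', hfreq⟩ := exists_subarc_frequently_mem hf hφ
    (fun t ht => disjoint_left.1 hPW ht (subset_closure (mem_range_self t)))
    (hs₀x ▸ iterate_mem_recurrentPts hf hx l)
  rw [hs₀x, ← iterate_add_apply] at hl'
  set J := (ψ ∘ σ) '' Icc α β with hJ
  have htJ : f^[l' + l] x ∈ J := hl' ▸ mem_image_of_mem _ ⟨hαt.le, htβ.le⟩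
  have hJnhds : J ∈ 𝓝 (f^[l' + l] x) :=
    hl' ▸ hφ.isOpenMap.image_mem_nhds (Icc_mem_nhds hαt htβ)
  obtain ⟨m, hm, hmJ⟩ := mem_recurrentPts_iff.1 (iterate_mem_recurrentPts hf hx (l' + l)) _ hJnhds 1
  obtain ⟨hcyc, hEP⟩ := hG.componentCyclic_closure_setOrbit hf hφ.isOpen_range hPW
    (isCompact_Icc.image hφ.continuous) (isPreconnected_Icc.image _ hφ.continuous.continuousOn)
    (by
      rintro _ ⟨s, hs, rfl⟩
      exact hfreq s hs)
    hm ⟨_, mem_image_of_mem _ htJ, hmJ⟩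
  refine ⟨closure (setOrbit f J), hcyc, isClosed_closure,
    closure_mono ?_ (mem_closure_orbit_of_recurrent hx (l' + l)), hEP⟩
  rintro _ ⟨n, rfl⟩
  exact mem_iUnion.2 ⟨n, mem_image_of_mem _ htJ⟩
end
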